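/- arXiv:2406.13241 — 12 statements merged into one kernel-verified Lean document; each statement's English description precedes it below -/
import Mathlib

section
/- Let φ = !![a, b; c, d] ∈ SL₂(ℤ) be Anosov. Then the following are equivalent: (1) there exists A ∈ GL₂(ℤ) such that either (φ·A = A·φ and det A = −1) or (φ·A = A·φ⁻¹ and det A = 1); (2) there exists B ∈ GL₂(ℤ) (i.e. an integer 2×2 matrix with det B = 1 or det B = −1) such that Q_φ((x, y)·B) = −Q_φ(x, y) for all integers x, y. (This is the algebraic content of the theorem that the oriented Sol torus bundle M_φ is achiral if and only if [−Q_φ] = ±[Q_φ] in the class group C(D_φ).) -/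
open Matrix

/-- `u(φ) = sgn(tr φ) · gcd(b, c, d − a)` for `φ = !![a,b;c,d]`. -/
def matU (φ : Matrix (Fin 2) (Fin 2) ℤ) : ℤ :=
  (φ 0 0 + φ 1 1).sign * (Int.gcd (φ 0 1) (Int.gcd (φ 1 0) (φ 1 1 - φ 0 0)) : ℤ)

/-- Discriminant `D_φ = ((a+d)² − 4)/u²`. -/
def matD (φ : Matrix (Fin 2) (Fin 2) ℤ) : ℤ :=
  ((φ 0 0 + φ 1 1) ^ 2 - 4) / (matU φ) ^ 2

/-- Quadratic form `Q_φ(x,y) = (c·x² + (d−a)·x·y − b·y²)/u`. -/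
def matQ (φ : Matrix (Fin 2) (Fin 2) ℤ) (x y : ℤ) : ℤ :=
  (φ 1 0 * x ^ 2 + (φ 1 1 - φ 0 0) * x * y - φ 0 1 * y ^ 2) / matU φ

/-- Inverse of a determinant-one 2×2 integer matrix. -/
def inv2 (φ : Matrix (Fin 2) (Fin 2) ℤ) : Matrix (Fin 2) (Fin 2) ℤ :=
  !![φ 1 1, -φ 0 1; -φ 1 0, φ 0 0]

/-- `φ ∈ SL₂(ℤ)` is Anosov: determinant one and `|tr φ| > 2`. -/
def IsAnosov (φ : Matrix (Fin 2) (Fin 2) ℤ) : Prop :=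
  φ.det = 1 ∧ 2 < |φ 0 0 + φ 1 1|

/-- `u(φ)` is nonzero for Anosov `φ`. -/
lemma matU_ne_zero {φ : Matrix (Fin 2) (Fin 2) ℤ} (hdet : φ.det = 1)
    (han : 2 < |φ 0 0 + φ 1 1|) : matU φ ≠ 0 := by
  intro h
  rw [det_fin_two] at hdet
  rcases mul_eq_zero.1 h with h | h
  · rw [Int.sign_eq_zero_iff_zero] at h
    simp [h] at han
  · have hg := Int.gcd_eq_zero_iff.1 (Int.natCast_eq_zero.1 h)
    have hg' := Int.gcd_eq_zero_iff.1 (Int.natCast_eq_zero.1 hg.2)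
    have had : φ 1 1 = φ 0 0 := by
      rcases hg' with ⟨-, h3⟩
      linarith
    have hsq : (φ 0 0 + φ 1 1) ^ 2 = 2 ^ 2 := by
      rw [hg.1, had] at hdet
      rw [had]
      linear_combination 4 * hdet
    rw [sq_eq_sq_iff_abs_eq_abs] at hsq
    norm_num at hsq
    omega

/-- The quadratic form `Q_φ` with its denominator cleared. -/
lemma matU_mul_matQ {φ : Matrix (Fin 2) (Fin 2) ℤ} (han : 2 < |φ 0 0 + φ 1 1|) (x y : ℤ) :
    matU φ * matQ φ x y = φ 1 0 * x ^ 2 + (φ 1 1 - φ 0 0) * x * y - φ 0 1 * y ^ 2 := by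
  refine Int.mul_ediv_cancel' ?_
  have ht : φ 0 0 + φ 1 1 ≠ 0 := by
    intro h
    simp [h] at han
  have hu : matU φ ∣ (Int.gcd (φ 0 1) (Int.gcd (φ 1 0) (φ 1 1 - φ 0 0)) : ℤ) := by
    have hs : IsUnit (φ 0 0 + φ 1 1).sign := by
      rcases lt_or_gt_of_ne ht with h | h
      · simp [Int.sign_eq_neg_one_of_neg h]
      · simp [Int.sign_eq_one_of_pos h]
    exact (hs.mul_left_dvd).2 dvd_rfl
  have hb : matU φ ∣ φ 0 1 := hu.trans (Int.gcd_dvd_left ..)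
  have hg : matU φ ∣ (Int.gcd (φ 1 0) (φ 1 1 - φ 0 0) : ℤ) := hu.trans (Int.gcd_dvd_right ..)
  have hc : matU φ ∣ φ 1 0 := hg.trans (Int.gcd_dvd_left ..)
  have hd : matU φ ∣ φ 1 1 - φ 0 0 := hg.trans (Int.gcd_dvd_right ..)
  exact dvd_sub (dvd_add (hc.mul_right _) ((hd.mul_right _).mul_right _)) (hb.mul_right _)

/-- Two values of `Q_φ` are opposite iff they are so after clearing the denominator. -/
lemma matQ_eq_neg_iff {φ : Matrix (Fin 2) (Fin 2) ℤ} (hdet : φ.det = 1)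
    (han : 2 < |φ 0 0 + φ 1 1|) (x y z w : ℤ) :
    matQ φ x y = -matQ φ z w ↔
      φ 1 0 * x ^ 2 + (φ 1 1 - φ 0 0) * x * y - φ 0 1 * y ^ 2 =
        -(φ 1 0 * z ^ 2 + (φ 1 1 - φ 0 0) * z * w - φ 0 1 * w ^ 2) := by
  rw [← matU_mul_matQ han, ← matU_mul_matQ han, ← mul_neg,
    mul_right_inj' (matU_ne_zero hdet han)]

/-- The oriented Sol torus bundle `M_φ` is achiral iff `[−Q_φ] = ±[Q_φ]`:
there is `A ∈ GL₂(ℤ)` with (`φA = Aφ`, `det A = −1`) or (`φA = Aφ⁻¹`, `det A = 1`)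
iff some `B ∈ GL₂(ℤ)` transforms `Q_φ` into `−Q_φ`. -/
theorem stmt0 (φ : Matrix (Fin 2) (Fin 2) ℤ) (hdet : φ.det = 1)
    (han : 2 < |φ 0 0 + φ 1 1|) :
    (∃ A : Matrix (Fin 2) (Fin 2) ℤ,
        (φ * A = A * φ ∧ A.det = -1) ∨ (φ * A = A * inv2 φ ∧ A.det = 1)) ↔
      (∃ B : Matrix (Fin 2) (Fin 2) ℤ, (B.det = 1 ∨ B.det = -1) ∧
        ∀ x y : ℤ,
          matQ φ (x * B 0 0 + y * B 1 0) (x * B 0 1 + y * B 1 1) = -matQ φ x y) := by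
  simp only [matQ_eq_neg_iff hdet han]
  rw [det_fin_two] at hdet
  constructor
  · rintro ⟨A, ⟨hA, hdA⟩ | ⟨hA, hdA⟩⟩
    all_goals
      refine ⟨Aᵀ, by simp [hdA], fun x y => ?_⟩
      have h00 := congrFun₂ hA 0 0
      have h01 := congrFun₂ hA 0 1
      have h10 := congrFun₂ hA 1 0
      have h11 := congrFun₂ hA 1 1
      simp [mul_apply, Fin.sum_univ_two, inv2] at h00 h01 h10 h11
      rw [det_fin_two] at hdA
      simp only [transpose_apply]
      grind
  · rintro ⟨B, hB, hQ⟩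
    have h10 := hQ 1 0
    have h01 := hQ 0 1
    have h11 := hQ 1 1
    simp only [det_fin_two] at hB
    refine ⟨Bᵀ, ?_⟩
    rcases hB with hB | hB
    · right
      refine ⟨?_, by rw [det_transpose, det_fin_two, hB]⟩
      ext i j
      fin_cases i <;> fin_cases j <;>
        simp [mul_apply, Fin.sum_univ_two, inv2] <;> grind
    · left
      refine ⟨?_, by rw [det_transpose, det_fin_two, hB]⟩
      ext i j
      fin_cases i <;> fin_cases j <;>
        simp [mul_apply, Fin.sum_univ_two] <;> grind
end

section
/- Let D be a nonsquare positive integer with D ≡ 0 or 1 (mod 4). Then the following are equivalent: (1) there exists an Anosov matrix φ ∈ SL₂(ℤ) with D_φ = D together with a matrix A ∈ GL₂(ℤ) such that either (φ·A = A·φ and det A = −1) or (φ·A = A·φ⁻¹ and det A = 1); (2) 16 does not divide D, and no prime factor of D is congruent to 3 mod 4. (This is the algebraic content of the theorem that there exists an achiral oriented Sol torus bundle of discriminant D if and only if 16 ∤ D and no prime factor of D is ≡ 3 mod 4.) -/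
open Matrix

/-- A prime `p ≡ 3 mod 4` dividing a sum of two squares divides the second term, hence both. -/
theorem dvd_of_dvd_sq_add_sq {p : ℕ} (hp : p.Prime) (h3 : p % 4 = 3) {x y : ℤ}
    (h : (p : ℤ) ∣ x ^ 2 + y ^ 2) : (p : ℤ) ∣ y := by
  have : Fact p.Prime := ⟨hp⟩
  by_contra hy
  have hy' : (y : ZMod p) ≠ 0 := fun h0 => hy ((ZMod.intCast_zmod_eq_zero_iff_dvd _ _).1 h0)
  have hxy : (x : ZMod p) ^ 2 = -(y : ZMod p) ^ 2 := by
    have := (ZMod.intCast_zmod_eq_zero_iff_dvd _ _).2 h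
    push_cast at this
    linear_combination this
  exact ZMod.mod_four_ne_three_of_sq_eq_neg_sq' hy' hxy h3

theorem dvd_of_dvd_sq_add_four_mul_sq {p : ℕ} (hp : p.Prime) (h3 : p % 4 = 3) {x y : ℤ}
    (h : (p : ℤ) ∣ x ^ 2 + 4 * y ^ 2) : (p : ℤ) ∣ y := by
  have h2 : (p : ℤ) ∣ 2 * y :=
    dvd_of_dvd_sq_add_sq hp h3 (x := x) (by convert h using 1; ring)
  refine ((Nat.prime_iff_prime_int.mp hp).dvd_or_dvd h2).resolve_left fun h => ?_
  have h' : p ∣ 2 := by exact_mod_cast h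
  have := (Nat.prime_dvd_prime_iff_eq hp Nat.prime_two).1 h'
  omega

theorem two_dvd_of_sixteen_dvd_sq_add_four_mul_sq {x y : ℤ}
    (h : 16 ∣ x ^ 2 + 4 * y ^ 2) : 2 ∣ y := by
  obtain ⟨k, hk⟩ := h
  have hx : (2 : ℤ) ∣ x := Int.prime_two.dvd_of_dvd_pow (n := 2) ⟨8 * k - 2 * y ^ 2, by linarith⟩
  obtain ⟨z, rfl⟩ := hx
  have h4 : z ^ 2 + y ^ 2 = 4 * k := by linarith
  rcases Int.even_or_odd' y with ⟨b, rfl | rfl⟩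
  · exact ⟨b, rfl⟩
  · rcases Int.even_or_odd' z with ⟨a, rfl | rfl⟩ <;> ring_nf at h4 <;> omega

/-- The entries of a matrix with `|tr φ| > 2` and determinant one, divided by their content,
are coprime and have discriminant `matD φ`. -/
theorem exists_primitive_of_isAnosov {φ : Matrix (Fin 2) (Fin 2) ℤ} (hφ : IsAnosov φ) :
    ∃ g b c e α β γ : ℤ, g ≠ 0 ∧ φ 0 1 = g * b ∧ φ 1 0 = g * c ∧ φ 1 1 - φ 0 0 = g * e ∧
      α * b + β * c + γ * e = 1 ∧ matD φ = e ^ 2 + 4 * b * c := by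
  obtain ⟨hdet, htr⟩ := hφ
  rw [Matrix.det_fin_two] at hdet
  set g₀ : ℤ := (Int.gcd (φ 1 0) (φ 1 1 - φ 0 0) : ℤ) with hg₀
  set g : ℤ := (Int.gcd (φ 0 1) g₀ : ℤ) with hg
  obtain ⟨b, hb⟩ : g ∣ φ 0 1 := Int.gcd_dvd_left ..
  have hgg : g ∣ g₀ := Int.gcd_dvd_right ..
  obtain ⟨c, hc⟩ : g ∣ φ 1 0 := hgg.trans (Int.gcd_dvd_left ..)
  obtain ⟨e, he⟩ : g ∣ φ 1 1 - φ 0 0 := hgg.trans (Int.gcd_dvd_right ..)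
  have bez₀ : g₀ = _ := Int.gcd_eq_gcd_ab (φ 1 0) (φ 1 1 - φ 0 0)
  have bez : g = _ := Int.gcd_eq_gcd_ab (φ 0 1) g₀
  have hdisc : (φ 0 0 + φ 1 1) ^ 2 - 4 = g ^ 2 * (e ^ 2 + 4 * b * c) := by
    linear_combination (φ 1 1 - φ 0 0 + g * e) * he + 4 * φ 1 0 * hb + 4 * g * b * hc + 4 * hdet
  have htr4 : 4 < (φ 0 0 + φ 1 1) ^ 2 := by
    rw [← sq_abs]; nlinarith
  have hg0 : g ≠ 0 := by
    rintro h0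
    rw [h0] at hdisc
    linarith
  have hu : matU φ ^ 2 = g ^ 2 := by
    have hs : (φ 0 0 + φ 1 1).sign ^ 2 = 1 := by
      rcases lt_trichotomy (φ 0 0 + φ 1 1) 0 with h | h | h
      · rw [Int.sign_eq_neg_one_of_neg h]; rfl
      · rw [h] at htr4; norm_num at htr4
      · rw [Int.sign_eq_one_of_pos h]; rfl
    rw [matU, mul_pow, hs, one_mul]
  refine ⟨g, b, c, e, Int.gcdA (φ 0 1) g₀, Int.gcdB (φ 0 1) g₀ * Int.gcdA (φ 1 0) (φ 1 1 - φ 0 0),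
    Int.gcdB (φ 0 1) g₀ * Int.gcdB (φ 1 0) (φ 1 1 - φ 0 0), hg0, hb, hc, he, ?_, ?_⟩
  · apply mul_left_cancel₀ hg0
    generalize Int.gcdA (φ 0 1) g₀ = x at *
    generalize Int.gcdB (φ 0 1) g₀ = y at *
    generalize Int.gcdA (φ 1 0) (φ 1 1 - φ 0 0) = z at *
    generalize Int.gcdB (φ 1 0) (φ 1 1 - φ 0 0) = w at *
    clear_value g g₀
    linear_combination -bez - x * hb - y * bez₀ - y * z * hc - y * w * he
  · rw [matD, hu, hdisc, Int.mul_ediv_cancel_left _ (pow_ne_zero 2 hg0)]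

/-- If a matrix of determinant `-1` commutes with `φ`, then `D U² = T² + 4` is solvable. -/
theorem exists_sq_add_four_of_commute {φ A : Matrix (Fin 2) (Fin 2) ℤ} (hφ : IsAnosov φ)
    (hA : φ * A = A * φ) (hdet : A.det = -1) : ∃ T U : ℤ, T ^ 2 + 4 = matD φ * U ^ 2 := by
  obtain ⟨g, b, c, e, α, β, γ, hg, hb, hc, he, hbez, hD⟩ := exists_primitive_of_isAnosov hφ
  have h00 := congrFun (congrFun hA 0) 0
  have h01 := congrFun (congrFun hA 0) 1
  have h10 := congrFun (congrFun hA 1) 0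
  simp only [Matrix.mul_apply, Fin.sum_univ_two] at h00 h01 h10
  rw [Matrix.det_fin_two] at hdet
  generalize A 0 0 = p at *
  generalize A 0 1 = q at *
  generalize A 1 0 = r at *
  generalize A 1 1 = s at *
  have k1 : b * r = c * q := mul_left_cancel₀ hg (by linear_combination h00 - r * hb + q * hc)
  have k2 : b * (s - p) = e * q :=
    mul_left_cancel₀ hg (by linear_combination h01 - (s - p) * hb + q * he)
  have k3 : c * (s - p) = e * r :=
    mul_left_cancel₀ hg (by linear_combination -h10 - (s - p) * hc + r * he)
  set U := α * q + β * r + γ * (s - p) with hU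
  have hq : q = b * U := by linear_combination -q * hbez - β * k1 - γ * k2
  have hr : r = c * U := by linear_combination -r * hbez + α * k1 - γ * k3
  have hs : s - p = e * U := by linear_combination -(s - p) * hbez + α * k2 + β * k3
  refine ⟨p + s, U, ?_⟩
  clear_value U
  rw [hD]
  linear_combination (s - p + e * U) * hs + 4 * r * hq + 4 * b * U * hr + 4 * hdet

/-- If a matrix of determinant `1` conjugates `φ` to its inverse, the primitive form attached to `φ`
satisfies two identities expressing multiples of its discriminant as sums of squares. -/
theorem exists_sq_mul_matD_of_conj_inv {φ A : Matrix (Fin 2) (Fin 2) ℤ} (hφ : IsAnosov φ)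
    (hA : φ * A = A * inv2 φ) (hdet : A.det = 1) :
    ∃ b c e α β γ q r x y : ℤ, α * b + β * c + γ * e = 1 ∧ matD φ = e ^ 2 + 4 * b * c ∧
      q ^ 2 * matD φ = x ^ 2 + 4 * b ^ 2 ∧ r ^ 2 * matD φ = y ^ 2 + 4 * c ^ 2 := by
  obtain ⟨g, b, c, e, α, β, γ, hg, hb, hc, he, hbez, hD⟩ := exists_primitive_of_isAnosov hφ
  have h00 := congrFun (congrFun hA 0) 0
  have h01 := congrFun (congrFun hA 0) 1
  have h10 := congrFun (congrFun hA 1) 0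
  have h11 := congrFun (congrFun hA 1) 1
  simp [Matrix.mul_apply, Fin.sum_univ_two, inv2] at h00 h01 h10 h11
  rw [Matrix.det_fin_two] at hdet
  generalize A 0 0 = p at *
  generalize A 0 1 = q at *
  generalize A 1 0 = r at *
  generalize A 1 1 = s at *
  have k1 : b * (p + s) = 0 :=
    mul_left_cancel₀ hg (by linear_combination h01 - (p + s) * hb)
  have k2 : c * (p + s) = 0 :=
    mul_left_cancel₀ hg (by linear_combination h10 - (p + s) * hc)
  have k3 : e * (p + s) = 0 :=
    mul_left_cancel₀ hg (by linear_combination h11 - h00 - (p + s) * he)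
  have k4 : e * s + c * q + b * r = 0 :=
    mul_left_cancel₀ hg (by linear_combination h11 - s * he - q * hc - r * hb)
  have hps : p = -s := by
    linear_combination -(p + s) * hbez + α * k1 + β * k2 + γ * k3
  subst hps
  refine ⟨b, c, e, α, β, γ, q, r, q * e - 2 * b * s, r * e - 2 * c * s, hbez, hD, ?_, ?_⟩
  · rw [hD]
    linear_combination 4 * q * b * k4 + 4 * b ^ 2 * hdet
  · rw [hD]
    linear_combination 4 * r * c * k4 + 4 * c ^ 2 * hdet

theorem not_sixteen_dvd_matD {φ A : Matrix (Fin 2) (Fin 2) ℤ} (hφ : IsAnosov φ)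
    (hA : (φ * A = A * φ ∧ A.det = -1) ∨ (φ * A = A * inv2 φ ∧ A.det = 1)) :
    ¬ 16 ∣ matD φ := by
  intro h
  rcases hA with ⟨hA, hdet⟩ | ⟨hA, hdet⟩
  · obtain ⟨T, U, hTU⟩ := exists_sq_add_four_of_commute hφ hA hdet
    have h2 : (2 : ℤ) ∣ 1 := two_dvd_of_sixteen_dvd_sq_add_four_mul_sq (x := T)
      (by rw [one_pow, mul_one, hTU]; exact h.mul_right _)
    norm_num at h2
  · obtain ⟨b, c, e, α, β, γ, q, r, x, y, hbez, hD, hq, hr⟩ :=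
      exists_sq_mul_matD_of_conj_inv hφ hA hdet
    have hb : 2 ∣ b := two_dvd_of_sixteen_dvd_sq_add_four_mul_sq (hq ▸ h.mul_left _)
    have hc : 2 ∣ c := two_dvd_of_sixteen_dvd_sq_add_four_mul_sq (hr ▸ h.mul_left _)
    have he : 2 ∣ e := by
      refine Int.prime_two.dvd_of_dvd_pow (n := 2) ?_
      rw [eq_sub_of_add_eq hD.symm]
      exact dvd_sub (dvd_trans (by norm_num) h) (hc.mul_left _)
    have h1 : (2 : ℤ) ∣ 1 :=
      hbez ▸ dvd_add (dvd_add (hb.mul_left _) (hc.mul_left _)) (he.mul_left _)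
    norm_num at h1

theorem mod_four_ne_three_of_dvd_matD {φ A : Matrix (Fin 2) (Fin 2) ℤ} (hφ : IsAnosov φ)
    (hA : (φ * A = A * φ ∧ A.det = -1) ∨ (φ * A = A * inv2 φ ∧ A.det = 1))
    {p : ℕ} (hp : p.Prime) (h : (p : ℤ) ∣ matD φ) : p % 4 ≠ 3 := by
  intro h3
  have hp' := Nat.prime_iff_prime_int.mp hp
  rcases hA with ⟨hA, hdet⟩ | ⟨hA, hdet⟩
  · obtain ⟨T, U, hTU⟩ := exists_sq_add_four_of_commute hφ hA hdet
    exact hp'.not_dvd_one (dvd_of_dvd_sq_add_four_mul_sq hp h3 (x := T)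
      (by rw [one_pow, mul_one, hTU]; exact h.mul_right _))
  · obtain ⟨b, c, e, α, β, γ, q, r, x, y, hbez, hD, hq, hr⟩ :=
      exists_sq_mul_matD_of_conj_inv hφ hA hdet
    have hb : (p : ℤ) ∣ b := dvd_of_dvd_sq_add_four_mul_sq hp h3 (hq ▸ h.mul_left _)
    have hc : (p : ℤ) ∣ c := dvd_of_dvd_sq_add_four_mul_sq hp h3 (hr ▸ h.mul_left _)
    have he : (p : ℤ) ∣ e := by
      refine hp'.dvd_of_dvd_pow (n := 2) ?_
      rw [eq_sub_of_add_eq hD.symm]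
      exact dvd_sub h (hc.mul_left _)
    exact hp'.not_dvd_one
      (hbez ▸ dvd_add (dvd_add (hb.mul_left _) (hc.mul_left _)) (he.mul_left _))

/-- If `p = a² + b²` is prime and `x`, `y` are coprime, then the real and imaginary parts of
`(x + i y) (a + i b)` are coprime unless `p` divides both. -/
theorem isCoprime_mul_of_prime_sq_add_sq {p x y a b : ℤ} (hp : Prime p) (hab : a ^ 2 + b ^ 2 = p)
    (hxy : IsCoprime x y) (h : ¬ (p ∣ x * a - y * b ∧ p ∣ x * b + y * a)) :
    IsCoprime (x * a - y * b) (x * b + y * a) := by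
  refine isCoprime_of_prime_dvd (fun h0 => h (by simp [h0.1, h0.2])) fun z hz h1 h2 => ?_
  have hx : z ∣ p * x := by
    have := dvd_add (h1.mul_right a) (h2.mul_right b)
    rw [← hab]
    ring_nf at this ⊢
    exact this
  have hy : z ∣ p * y := by
    have := dvd_sub (h2.mul_right a) (h1.mul_right b)
    rw [← hab]
    ring_nf at this ⊢
    exact this
  by_cases hzp : z ∣ p
  · have hpz : p ∣ z := (hz.dvd_prime_iff_associated hp).1 hzp |>.symm.dvd
    exact h ⟨hpz.trans h1, hpz.trans h2⟩
  · exact hz.not_isUnit (hxy.isUnit_of_dvd' ((hz.dvd_or_dvd hx).resolve_left hzp)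
      ((hz.dvd_or_dvd hy).resolve_left hzp))

/-- An odd number without prime factors `≡ 3 mod 4` is a sum of two coprime squares. -/
theorem exists_isCoprime_sq_add_sq (n : ℕ) (hodd : Odd n)
    (hn : ∀ p : ℕ, p.Prime → p ∣ n → p % 4 ≠ 3) :
    ∃ x y : ℤ, (n : ℤ) = x ^ 2 + y ^ 2 ∧ IsCoprime x y := by
  induction n using induction_on_primes with
  | zero => exact absurd hodd (by decide)
  | one => exact ⟨1, 0, by norm_num, isCoprime_one_left⟩
  | prime_mul p n hp ih =>
    have : Fact p.Prime := ⟨hp⟩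
    obtain ⟨hpo, hno⟩ := Nat.odd_mul.1 hodd
    obtain ⟨x, y, hxy, hco⟩ := ih hno fun q hq hqn => hn q hq (hqn.mul_left _)
    obtain ⟨a, b, hab⟩ := Nat.Prime.sq_add_sq (hn p hp (dvd_mul_right _ _))
    have hab' : (a : ℤ) ^ 2 + (b : ℤ) ^ 2 = p := by exact_mod_cast hab
    have hp' : Prime (p : ℤ) := Nat.prime_iff_prime_int.mp hp
    by_cases h : (p : ℤ) ∣ x * a - y * b ∧ (p : ℤ) ∣ x * b + y * a
    · refine ⟨x * a - y * (-b), x * (-b) + y * a, ?_, isCoprime_mul_of_prime_sq_add_sq hp'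
        (by rw [neg_sq]; exact hab') hco ?_⟩
      · push_cast; rw [hxy, ← hab']; ring
      · rintro ⟨h1, h2⟩
        have hp2 : ¬ (p : ℤ) ∣ 2 := fun h => by
          have h' : p ∣ 2 := by exact_mod_cast h
          rw [(Nat.prime_dvd_prime_iff_eq hp Nat.prime_two).1 h'] at hpo
          exact absurd hpo (by decide)
        have ha : ¬ (p : ℤ) ∣ a := fun ha => by
          have hb : (p : ℤ) ∣ b := by
            refine hp'.dvd_of_dvd_pow (n := 2) ?_
            rw [eq_sub_of_add_eq' hab']
            exact dvd_sub dvd_rfl (dvd_pow ha two_ne_zero)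
          obtain ⟨a', ha⟩ := ha
          obtain ⟨b', hb⟩ := hb
          rw [ha, hb] at hab'
          exact hp'.not_dvd_one ⟨a' ^ 2 + b' ^ 2,
            mul_left_cancel₀ hp'.ne_zero (by linear_combination -hab')⟩
        have key : ∀ z : ℤ, (p : ℤ) ∣ 2 * (a * z) → (p : ℤ) ∣ z := fun z hz =>
          (hp'.dvd_or_dvd ((hp'.dvd_or_dvd hz).resolve_left hp2)).resolve_left ha
        refine hp'.not_isUnit (hco.isUnit_of_dvd' (key x ?_) (key y ?_))
        · have := dvd_add h.1 h1
          ring_nf at this ⊢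
          exact this
        · have := dvd_add h.2 h2
          ring_nf at this ⊢
          exact this
    · exact ⟨_, _, by push_cast; rw [hxy, ← hab']; ring,
        isCoprime_mul_of_prime_sq_add_sq hp' hab' hco h⟩

/-- A discriminant not divisible by `16` and without prime factors `≡ 3 mod 4` is of the form
`e² + 4 k²` with `e` and `k` coprime. -/
theorem exists_isCoprime_sq_add_four_mul_sq {D : ℤ} (hpos : 0 < D)
    (hmod : D % 4 = 0 ∨ D % 4 = 1) (h16 : ¬ 16 ∣ D)
    (hD : ∀ p : ℕ, p.Prime → (p : ℤ) ∣ D → p % 4 ≠ 3) :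
    ∃ e k : ℤ, D = e ^ 2 + 4 * k ^ 2 ∧ IsCoprime e k := by
  have main : ∀ m : ℤ, 0 < m → m % 2 = 1 → m ∣ D →
      ∃ x y : ℤ, m = x ^ 2 + (2 * y) ^ 2 ∧ IsCoprime x (2 * y) := by
    intro m hm0 hm2 hmD
    lift m to ℕ using hm0.le
    obtain ⟨x, y, hxy, hco⟩ := exists_isCoprime_sq_add_sq m (Nat.odd_iff.2 (by omega))
      fun p hp hpm => hD p hp ((Int.natCast_dvd_natCast.2 hpm).trans hmD)
    rcases Int.even_or_odd' y with ⟨b, rfl | rfl⟩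
    · exact ⟨x, b, hxy, hco⟩
    · rcases Int.even_or_odd' x with ⟨a, rfl | rfl⟩
      · exact ⟨_, a, by rw [hxy]; ring, hco.symm⟩
      · ring_nf at hxy; omega
  have odd_left : ∀ {m x y : ℤ}, m = x ^ 2 + (2 * y) ^ 2 → m % 2 = 1 → Odd x := by
    rintro m x y rfl hm
    rcases Int.even_or_odd' x with ⟨a, rfl | rfl⟩
    · ring_nf at hm; omega
    · exact ⟨a, rfl⟩
  rcases hmod with h | h
  · obtain ⟨n, rfl⟩ : (4 : ℤ) ∣ D := Int.dvd_of_emod_eq_zero h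
    rcases Int.even_or_odd' n with ⟨m, rfl | rfl⟩
    · obtain ⟨x, y, hxy, hco⟩ := main m (by omega) (by omega) ⟨8, by ring⟩
      obtain ⟨w, rfl⟩ := odd_left hxy (by omega)
      obtain ⟨α, β, hαβ⟩ := hco
      refine ⟨2 * (2 * w + 1 + 2 * y), 2 * w + 1 - 2 * y, by rw [hxy]; ring,
        (Int.isCoprime_two_left.2 ⟨w - y, by ring⟩).mul_left
          ⟨-(w - y) * (α + β), 1 - (w - y) * (α - β), ?_⟩⟩
      linear_combination -2 * (w - y) * hαβ
    · obtain ⟨x, y, hxy, hco⟩ := main (2 * m + 1) (by omega) (by omega) ⟨4, by ring⟩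
      exact ⟨2 * (2 * y), x, by rw [hxy]; ring,
        (Int.isCoprime_two_left.2 (odd_left hxy (by omega))).mul_left hco.symm⟩
  · obtain ⟨x, y, hxy, hco⟩ := main D hpos (by omega) dvd_rfl
    exact ⟨x, y, by rw [hxy]; ring, hco.of_mul_right_right⟩

/-- A symmetric Anosov matrix attached to a solution of `x² - D y² = 1`, `D = e² + 4 k²`. -/
theorem matD_symmetric {D e k x y : ℤ} (hD : D = e ^ 2 + 4 * k ^ 2) (hek : IsCoprime e k)
    (hpos : 0 < D) (hxy : x ^ 2 - D * y ^ 2 = 1) (hy : y ≠ 0) :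
    IsAnosov !![x - y * e, 2 * y * k; 2 * y * k, x + y * e] ∧
      matD !![x - y * e, 2 * y * k; 2 * y * k, x + y * e] = D := by
  have hy2 : 0 < y ^ 2 := by positivity
  have hx : 1 < x ^ 2 := by nlinarith
  have hx' : 1 < |x| := (one_lt_sq_iff_one_lt_abs x).1 hx
  have hdet : (x - y * e) * (x + y * e) - 2 * y * k * (2 * y * k) = 1 := by
    rw [hD] at hxy; linear_combination hxy
  have htr : x - y * e + (x + y * e) = 2 * x := by ring
  refine ⟨⟨by rw [Matrix.det_fin_two_of, hdet], ?_⟩, ?_⟩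
  · simp only [Matrix.of_apply, Matrix.cons_val', Matrix.cons_val_zero, Matrix.cons_val_one,
      Matrix.cons_val_fin_one, htr, abs_mul]
    norm_num
    linarith
  · have hs : (2 * x).sign ^ 2 = 1 := by
      rcases lt_trichotomy x 0 with h | h | h
      · rw [Int.sign_eq_neg_one_of_neg (by linarith)]; rfl
      · rw [h] at hx; norm_num at hx
      · rw [Int.sign_eq_one_of_pos (by linarith)]; rfl
    have hgcd : Int.gcd (2 * y * k) (Int.gcd (2 * y * k) (2 * y * e)) = (2 * y).natAbs := by
      rw [Int.gcd_mul_left, Int.gcd_comm k e, Int.isCoprime_iff_gcd_eq_one.1 hek, mul_one]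
      exact Nat.gcd_eq_right (by rw [Int.natAbs_mul (2 * y) k]; exact dvd_mul_right _ _)
    have hsub : x + y * e - (x - y * e) = 2 * y * e := by ring
    simp only [matD, matU, Matrix.of_apply, Matrix.cons_val', Matrix.cons_val_zero,
      Matrix.cons_val_one, Matrix.cons_val_fin_one, htr, hsub, hgcd, mul_pow, hs]
    rw [Int.natCast_natAbs, sq_abs]
    have : 2 ^ 2 * x ^ 2 - 4 = D * (1 * (2 * y) ^ 2) := by linear_combination 4 * hxy
    rw [this, Int.mul_ediv_cancel _ (by positivity)]

/-- There is an achiral oriented Sol torus bundle of discriminant `D` iff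
`16 ∤ D` and no prime factor of `D` is `≡ 3 mod 4`. -/
theorem stmt1 (D : ℤ) (hpos : 0 < D) (hns : ¬ IsSquare D)
    (hmod : D % 4 = 0 ∨ D % 4 = 1) :
    (∃ φ : Matrix (Fin 2) (Fin 2) ℤ, φ.det = 1 ∧ 2 < |φ 0 0 + φ 1 1| ∧ matD φ = D ∧
        ∃ A : Matrix (Fin 2) (Fin 2) ℤ,
          (φ * A = A * φ ∧ A.det = -1) ∨ (φ * A = A * inv2 φ ∧ A.det = 1)) ↔
      (¬ (16 ∣ D) ∧ ∀ p : ℕ, p.Prime → (p : ℤ) ∣ D → p % 4 ≠ 3) := by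
  constructor
  · rintro ⟨φ, hdet, htr, rfl, A, hA⟩
    exact ⟨not_sixteen_dvd_matD ⟨hdet, htr⟩ hA,
      fun p hp hpD => mod_four_ne_three_of_dvd_matD ⟨hdet, htr⟩ hA hp hpD⟩
  · rintro ⟨h16, hp⟩
    obtain ⟨e, k, hD, hek⟩ := exists_isCoprime_sq_add_four_mul_sq hpos hmod h16 hp
    obtain ⟨x, y, hxy, hy⟩ := Pell.exists_of_not_isSquare hpos hns
    obtain ⟨⟨hdet, htr⟩, hmatD⟩ := matD_symmetric hD hek hpos hxy hy
    refine ⟨_, hdet, htr, hmatD, !![0, -1; 1, 0], Or.inr ⟨?_, by simp⟩⟩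
    ext i j
    fin_cases i <;> fin_cases j <;> simp [inv2, Matrix.mul_apply, Fin.sum_univ_two]
end

section
/- Let D be a nonsquare positive integer with D ≡ 0 or 1 (mod 4). Then there exists an Anosov matrix φ ∈ SL₂(ℤ) with D_φ = D. -/
open Matrix

/-- The matrix of multiplication by the unit `x + y√D` on the order of discriminant `D = 4k + e`. -/
def unitMatrix (k e x y : ℤ) : Matrix (Fin 2) (Fin 2) ℤ :=
  !![x - e * y, 2 * y * k; 2 * y, x + e * y]

theorem matU_unitMatrix (k e : ℤ) {x y : ℤ} (hx : 0 < x) (hy : 0 < y) :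
    matU (unitMatrix k e x y) = 2 * y := by
  have htr : x - e * y + (x + e * y) = 2 * x := by ring
  have hdiff : x + e * y - (x - e * y) = 2 * y * e := by ring
  have hpos : (0 : ℤ) ≤ 2 * y := by positivity
  have hinner : ((Int.gcd (2 * y) (2 * y * e) : ℕ) : ℤ) = 2 * y := by
    rw [Int.gcd_eq_natAbs_left (dvd_mul_right _ _), Int.natAbs_of_nonneg hpos]
  have houter : ((Int.gcd (2 * y * k) (2 * y) : ℕ) : ℤ) = 2 * y := by
    rw [Int.gcd_eq_natAbs_right (dvd_mul_right _ _), Int.natAbs_of_nonneg hpos]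
  have hsign : (2 * x).sign = 1 := Int.sign_eq_one_of_pos (by positivity)
  simp only [matU, unitMatrix, Matrix.of_apply, Matrix.cons_val', Matrix.cons_val_zero,
    Matrix.cons_val_one, Matrix.cons_val_fin_one]
  rw [htr, hdiff, hinner, houter, hsign, one_mul]

theorem trace_unitMatrix (k e x y : ℤ) :
    unitMatrix k e x y 0 0 + unitMatrix k e x y 1 1 = 2 * x := by
  simp [unitMatrix]
  ring

/-- Every nonsquare positive integer `D ≡ 0, 1 mod 4` is the discriminant of some
Anosov `φ ∈ SL₂(ℤ)`. -/
theorem stmt2 (D : ℤ) (hpos : 0 < D) (hns : ¬ IsSquare D)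
    (hmod : D % 4 = 0 ∨ D % 4 = 1) :
    ∃ φ : Matrix (Fin 2) (Fin 2) ℤ, φ.det = 1 ∧ 2 < |φ 0 0 + φ 1 1| ∧ matD φ = D := by
  obtain ⟨k, e, rfl, he⟩ : ∃ k e : ℤ, D = 4 * k + e ∧ e ^ 2 = e := by
    rcases hmod with h | h
    · exact ⟨D / 4, 0, by omega, by norm_num⟩
    · exact ⟨D / 4, 1, by omega, by norm_num⟩
  obtain ⟨s, hx, hy⟩ := Pell.Solution₁.exists_pos_of_not_isSquare hpos hns
  have hpell := s.prop
  refine ⟨unitMatrix k e s.x s.y, ?_, ?_, ?_⟩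
  · rw [unitMatrix, Matrix.det_fin_two_of]
    linear_combination hpell - s.y ^ 2 * he
  · rw [trace_unitMatrix, abs_of_pos (by linarith)]
    linarith
  · rw [matD, matU_unitMatrix k e (by linarith) hy, trace_unitMatrix]
    exact Int.ediv_eq_of_eq_mul_left (by positivity) (by linear_combination 4 * hpell)
end

section
/- Let φ ∈ SL₂(ℤ) be Anosov and let n ≥ 1 be an integer. Then φⁿ is Anosov and Q_{φⁿ}(x, y) = Q_φ(x, y) for all integers x, y. -/
open Matrix

/-- Cayley–Hamilton for a `2 × 2` integer matrix of determinant one. -/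
theorem mul_self_eq_of_det_eq_one (φ : Matrix (Fin 2) (Fin 2) ℤ) (hdet : φ.det = 1) :
    φ * φ = (φ 0 0 + φ 1 1) • φ - 1 := by
  rw [Matrix.det_fin_two] at hdet
  ext i j
  fin_cases i <;> fin_cases j <;>
    simp [Matrix.mul_apply, Fin.sum_univ_two, -zsmul_eq_mul] <;> linarith

/-- Positive powers of a matrix of determinant one and trace `s * t`, with `s = ± 1` and `3 ≤ t`,
are integer combinations of the matrix and the identity, with control on the coefficients. -/
theorem exists_pow_succ_eq_smul_add (φ : Matrix (Fin 2) (Fin 2) ℤ) (hdet : φ.det = 1) (s t : ℤ)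
    (hs : s * s = 1) (ht : 3 ≤ t) (htr : φ 0 0 + φ 1 1 = s * t) (n : ℕ) :
    ∃ e K L : ℤ, e * e = 1 ∧ 0 ≤ L ∧ L < K ∧
      φ ^ (n + 1) = (s * e * K) • φ + (-(e * L)) • (1 : Matrix (Fin 2) (Fin 2) ℤ) := by
  induction n with
  | zero => exact ⟨s, 1, 0, hs, le_rfl, one_pos, by simp [hs]⟩
  | succ n ih =>
    obtain ⟨e, K, L, he, hL, hLK, h⟩ := ih
    refine ⟨s * e, K * t - L, K, by linear_combination (e * e) * hs + he, by linarith,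
      by nlinarith, ?_⟩
    rw [pow_succ, h, add_mul, smul_mul_assoc, mul_self_eq_of_det_eq_one φ hdet, htr, smul_mul_assoc,
      one_mul]
    ext i j
    simp only [Matrix.add_apply, Matrix.smul_apply, Matrix.sub_apply, smul_eq_mul]
    linear_combination (e * L * φ i j) * hs

/-- The entries of `k • φ + m • 1`. -/
theorem smul_add_smul_one_apply (φ : Matrix (Fin 2) (Fin 2) ℤ) (k m : ℤ) (i j : Fin 2) :
    (k • φ + m • (1 : Matrix (Fin 2) (Fin 2) ℤ)) i j = k * φ i j + if i = j then m else 0 := by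
  rw [Matrix.add_apply, Matrix.smul_apply, Matrix.smul_apply, Matrix.one_apply, smul_eq_mul,
    smul_eq_mul, mul_ite, mul_one, mul_zero]

/-- The trace of `k • φ + m • 1`. -/
theorem trace_smul_add_smul_one (φ : Matrix (Fin 2) (Fin 2) ℤ) (k m : ℤ) :
    (k • φ + m • (1 : Matrix (Fin 2) (Fin 2) ℤ)) 0 0 +
      (k • φ + m • (1 : Matrix (Fin 2) (Fin 2) ℤ)) 1 1 = k * (φ 0 0 + φ 1 1) + 2 * m := by
  simp only [smul_add_smul_one_apply, if_true]
  ring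

/-- `u(φ)` divides every value of the numerator of `Q_φ` when the trace is nonzero. -/
theorem matU_dvd (φ : Matrix (Fin 2) (Fin 2) ℤ) (htr : φ 0 0 + φ 1 1 ≠ 0) (x y : ℤ) :
    matU φ ∣ φ 1 0 * x ^ 2 + (φ 1 1 - φ 0 0) * x * y - φ 0 1 * y ^ 2 := by
  have hu : IsUnit (φ 0 0 + φ 1 1).sign := by
    rcases Int.lt_or_gt_of_ne htr with h | h
    · simp [Int.sign_eq_neg_one_of_neg h]
    · simp [Int.sign_eq_one_of_pos h]
  rw [matU, hu.mul_left_dvd, mul_assoc]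
  have h := Int.gcd_dvd_right (φ 0 1) (Int.gcd (φ 1 0) (φ 1 1 - φ 0 0))
  exact dvd_sub
    (dvd_add ((h.trans (Int.gcd_dvd_left _ _)).mul_right _)
      ((h.trans (Int.gcd_dvd_right _ _)).mul_right _))
    ((Int.gcd_dvd_left _ _).mul_right _)

/-- `Q` is unchanged under `φ ↦ k • φ + m • 1` when the sign of the trace changes by the sign
of `k ≠ 0`. -/
theorem matQ_smul_add_smul_one (φ : Matrix (Fin 2) (Fin 2) ℤ) (k m : ℤ) (hk : k ≠ 0)
    (htr : φ 0 0 + φ 1 1 ≠ 0)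
    (hsign : (k * (φ 0 0 + φ 1 1) + 2 * m).sign = k.sign * (φ 0 0 + φ 1 1).sign) (x y : ℤ) :
    matQ (k • φ + m • (1 : Matrix (Fin 2) (Fin 2) ℤ)) x y = matQ φ x y := by
  have hb : (k • φ + m • (1 : Matrix (Fin 2) (Fin 2) ℤ)) 0 1 = k * φ 0 1 := by
    simp [-zsmul_eq_mul, -zsmul_one]
  have hc : (k • φ + m • (1 : Matrix (Fin 2) (Fin 2) ℤ)) 1 0 = k * φ 1 0 := by
    simp [-zsmul_eq_mul, -zsmul_one]
  have hd : (k • φ + m • (1 : Matrix (Fin 2) (Fin 2) ℤ)) 1 1 -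
      (k • φ + m • (1 : Matrix (Fin 2) (Fin 2) ℤ)) 0 0 = k * (φ 1 1 - φ 0 0) := by
    simp only [smul_add_smul_one_apply, if_true]
    ring
  have hU : matU (k • φ + m • (1 : Matrix (Fin 2) (Fin 2) ℤ)) = k * matU φ := by
    have hg : Int.gcd (k * φ 0 1) (Int.gcd (k * φ 1 0) (k * (φ 1 1 - φ 0 0))) =
        k.natAbs * Int.gcd (φ 0 1) (Int.gcd (φ 1 0) (φ 1 1 - φ 0 0)) := by
      simp only [Int.gcd, Int.natAbs_mul, Nat.gcd_mul_left, Int.natAbs_natCast]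
    unfold matU
    rw [trace_smul_add_smul_one, hsign, hb, hc, hd, hg, Nat.cast_mul]
    linear_combination ((φ 0 0 + φ 1 1).sign *
      (Int.gcd (φ 0 1) (Int.gcd (φ 1 0) (φ 1 1 - φ 0 0)) : ℤ)) * Int.sign_mul_natAbs k
  unfold matQ
  rw [hU, hb, hc, hd, ← EuclideanDomain.mul_div_mul_cancel hk (matU_dvd φ htr x y)]
  congr 1
  ring

/-- For Anosov `φ ∈ SL₂(ℤ)` and `n ≥ 1`, `φⁿ` is Anosov and `Q_{φⁿ} = Q_φ`. -/
theorem stmt3 (φ : Matrix (Fin 2) (Fin 2) ℤ) (hdet : φ.det = 1)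
    (han : 2 < |φ 0 0 + φ 1 1|) (n : ℕ) (hn : 1 ≤ n) :
    (φ ^ n).det = 1 ∧ 2 < |(φ ^ n) 0 0 + (φ ^ n) 1 1| ∧
      ∀ x y : ℤ, matQ (φ ^ n) x y = matQ φ x y := by
  obtain ⟨m, rfl⟩ : ∃ m, n = m + 1 := ⟨n - 1, by omega⟩
  have ht0 : φ 0 0 + φ 1 1 ≠ 0 := by
    intro h
    simp [h] at han
  have htr : φ 0 0 + φ 1 1 = (φ 0 0 + φ 1 1).sign * |φ 0 0 + φ 1 1| :=
    (Int.sign_mul_abs _).symm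
  have hs : (φ 0 0 + φ 1 1).sign * (φ 0 0 + φ 1 1).sign = 1 := by
    rcases Int.lt_or_gt_of_ne ht0 with h | h
    · simp [Int.sign_eq_neg_one_of_neg h]
    · simp [Int.sign_eq_one_of_pos h]
  generalize (φ 0 0 + φ 1 1).sign = s at htr hs
  generalize |φ 0 0 + φ 1 1| = t at htr han
  obtain ⟨e, K, L, he, hL, hLK, h⟩ := exists_pow_succ_eq_smul_add φ hdet s t hs han htr m
  have hT : s * e * K * (φ 0 0 + φ 1 1) + 2 * -(e * L) = e * (K * t - 2 * L) := by
    rw [htr]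
    linear_combination (e * K * t) * hs
  have hpos : 2 < K * t - 2 * L := by nlinarith
  refine ⟨by rw [Matrix.det_pow, hdet, one_pow], ?_, fun x y => ?_⟩
  · have h1 : |e| = 1 := by rcases mul_self_eq_one_iff.mp he with rfl | rfl <;> rfl
    rwa [h, trace_smul_add_smul_one, hT, abs_mul, h1, one_mul, abs_of_pos (by linarith)]
  · rw [h]
    have hs0 : s ≠ 0 := by rintro rfl; simp at hs
    have he0 : e ≠ 0 := by rintro rfl; simp at he
    refine matQ_smul_add_smul_one φ _ _ (mul_ne_zero (mul_ne_zero hs0 he0) (by linarith)) ht0 ?_ x y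
    have hss : s.sign * s.sign = 1 := by rw [← Int.sign_mul, hs]; rfl
    rw [hT, htr]
    simp only [Int.sign_mul]
    rw [Int.sign_eq_one_of_pos (show 0 < K * t - 2 * L by linarith),
      Int.sign_eq_one_of_pos (show 0 < K by linarith),
      Int.sign_eq_one_of_pos (show 0 < t by linarith)]
    linear_combination (-e.sign) * hss
end

section
/- Let φ₁, φ₂ ∈ SL₂(ℤ) be Anosov matrices such that Q_{φ₁} is SL₂(ℤ)-equivalent to Q_{φ₂}. Then there exist a matrix α ∈ SL₂(ℤ), positive integers m, n, and signs ε₁, ε₂ ∈ {1, −1} such that φ₁ is SL₂(ℤ)-conjugate to ε₁·α^m and φ₂ is SL₂(ℤ)-conjugate to ε₂·α^n. -/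
open Matrix

/-- The matrix `s + u N`, where `N = !![0, -C; A, B]` is attached to the form
`A x² + B x y + C y²`. -/
def formMatrix (A B C s u : ℤ) : Matrix (Fin 2) (Fin 2) ℤ :=
  !![s, -(u * C); u * A, s + u * B]

theorem det_formMatrix (A B C s u : ℤ) :
    (formMatrix A B C s u).det = s ^ 2 + s * u * B + A * C * u ^ 2 := by
  simp only [formMatrix, det_fin_two_of]
  ring

theorem formMatrix_mul (A B C s u s' u' : ℤ) :
    formMatrix A B C s u * formMatrix A B C s' u' =
      formMatrix A B C (s * s' - u * u' * (A * C)) (s * u' + u * s' + u * u' * B) := by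
  ext i j
  fin_cases i <;> fin_cases j <;> simp [formMatrix, mul_apply, Fin.sum_univ_two] <;> ring

/-- A pair `(s, u)` such that `formMatrix A B C s u` has determinant one,
positive trace and `0 < u`. -/
def IsPositiveUnit (A B C s u : ℤ) : Prop :=
  s ^ 2 + s * u * B + A * C * u ^ 2 = 1 ∧ 0 < 2 * s + u * B ∧ 0 < u

theorem exists_formMatrix_eq_pow {A B C s₀ u₀ : ℤ} (hD : 0 < B ^ 2 - 4 * A * C)
    (h₀ : IsPositiveUnit A B C s₀ u₀)
    (hmin : ∀ s u, IsPositiveUnit A B C s u → u₀ ≤ u) (n : ℕ) :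
    ∀ s u, u.toNat = n → IsPositiveUnit A B C s u →
      ∃ k : ℕ, formMatrix A B C s u = formMatrix A B C s₀ u₀ ^ (k + 1) := by
  induction n using Nat.strong_induction_on with
  | _ n ih =>
  intro s u hn h
  have hu := hmin s u h
  obtain ⟨e₀, t₀_pos, u₀_pos⟩ := h₀
  obtain ⟨e, t_pos, u_pos⟩ := h
  obtain ⟨t₀, ht₀⟩ : ∃ t₀, t₀ = 2 * s₀ + u₀ * B := ⟨_, rfl⟩
  obtain ⟨t, ht⟩ : ∃ t, t = 2 * s + u * B := ⟨_, rfl⟩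
  obtain ⟨D, hDdef⟩ : ∃ D, D = B ^ 2 - 4 * A * C := ⟨_, rfl⟩
  have pell₀ : t₀ ^ 2 = 4 + D * u₀ ^ 2 := by subst ht₀ hDdef; linear_combination 4 * e₀
  have pell : t ^ 2 = 4 + D * u ^ 2 := by subst ht hDdef; linear_combination 4 * e
  rw [← ht₀] at t₀_pos
  rw [← ht] at t_pos
  rw [← hDdef] at hD
  obtain ⟨s', hs'⟩ : ∃ s', s' = s * (s₀ + u₀ * B) + u * u₀ * (A * C) := ⟨_, rfl⟩
  obtain ⟨u', hu'⟩ : ∃ u', u' = u * s₀ - s * u₀ := ⟨_, rfl⟩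
  have two_u' : 2 * u' = u * t₀ - t * u₀ := by subst hu' ht ht₀; ring
  have two_t' : 2 * (2 * s' + u' * B) = t * t₀ - D * (u * u₀) := by
    subst hs' hu' ht ht₀ hDdef; ring
  have two_lt_t₀ : 2 < t₀ := by
    have : 0 < D * u₀ ^ 2 := by positivity
    nlinarith
  have u'_nonneg : 0 ≤ u' := by
    have : t * u₀ ≤ u * t₀ := by
      refine le_of_sq_le_sq ?_ (by positivity)
      have : u₀ ^ 2 ≤ u ^ 2 := by gcongr
      linear_combination 4 * this + u₀ ^ 2 * pell - u ^ 2 * pell₀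
    linarith
  have u'_lt : u' < u := by
    have : u * (t₀ - 2) < t * u₀ := by
      refine lt_of_pow_lt_pow_left₀ 2 (by positivity) ?_
      have h1 : 0 < u ^ 2 * (t₀ - 2) := mul_pos (by positivity) (by linarith)
      have h2 : 0 < u₀ ^ 2 := by positivity
      linear_combination 4 * h1 + 4 * h2 + u ^ 2 * pell₀ - u₀ ^ 2 * pell
    linarith
  have t'_pos : 0 < 2 * s' + u' * B := by
    have : D * (u * u₀) < t * t₀ := by
      refine lt_of_pow_lt_pow_left₀ 2 (by positivity) ?_
      have h1 : 0 < D * u ^ 2 := by positivity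
      have h2 : 0 < D * u₀ ^ 2 := by positivity
      rw [mul_pow t t₀, pell, pell₀]
      linear_combination 4 * h1 + 4 * h2
    linarith
  have e' : s' ^ 2 + s' * u' * B + A * C * u' ^ 2 = 1 := by
    subst hs' hu'
    linear_combination (s ^ 2 + s * u * B + A * C * u ^ 2) * e₀ + e
  have hmul : formMatrix A B C s u = formMatrix A B C s' u' * formMatrix A B C s₀ u₀ := by
    rw [formMatrix_mul]
    subst hs' hu'
    congr 1
    · linear_combination (-s) * e₀
    · linear_combination (-u) * e₀
  rcases u'_nonneg.eq_or_lt with h0 | u'_pos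
  · refine ⟨0, ?_⟩
    have hs1 : s' = 1 := by
      rw [← h0] at e' t'_pos
      nlinarith
    rw [hmul, hs1, ← h0]
    ext i j
    fin_cases i <;> fin_cases j <;> simp [formMatrix, mul_apply, Fin.sum_univ_two]
  · obtain ⟨k, hk⟩ := ih u'.toNat (by omega) s' u' rfl ⟨e', t'_pos, u'_pos⟩
    exact ⟨k + 1, by rw [hmul, hk, ← pow_succ]⟩

/-- The matrices with positive trace attached to a form are the positive powers of one of them. -/
theorem exists_generator {A B C : ℤ} (hD : 0 < B ^ 2 - 4 * A * C)
    (hne : ∃ s u, IsPositiveUnit A B C s u) :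
    ∃ α : Matrix (Fin 2) (Fin 2) ℤ, α.det = 1 ∧ ∀ s u, IsPositiveUnit A B C s u →
      ∃ k : ℕ, formMatrix A B C s u = α ^ (k + 1) := by
  classical
  have hex : ∃ n : ℕ, ∃ s, IsPositiveUnit A B C s n := by
    obtain ⟨s, u, h⟩ := hne
    exact ⟨u.toNat, s, by rwa [Int.toNat_of_nonneg h.2.2.le]⟩
  obtain ⟨s₀, h₀⟩ := Nat.find_spec hex
  have hmin : ∀ s u, IsPositiveUnit A B C s u → (Nat.find hex : ℤ) ≤ u := by
    intro s u h
    have : Nat.find hex ≤ u.toNat :=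
      Nat.find_min' hex ⟨s, by rwa [Int.toNat_of_nonneg h.2.2.le]⟩
    have := h.2.2
    omega
  exact ⟨_, (det_formMatrix ..).trans h₀.1, fun s u h =>
    exists_formMatrix_eq_pow hD h₀ hmin u.toNat s u rfl h⟩

theorem IsAnosov.exists_formMatrix {φ : Matrix (Fin 2) (Fin 2) ℤ} (h : IsAnosov φ) :
    ∃ A B C s u ε : ℤ, (ε = 1 ∨ ε = -1) ∧ 0 < B ^ 2 - 4 * A * C ∧ IsPositiveUnit A B C s u ∧
      φ = ε • formMatrix A B C s u ∧ ∀ x y, matQ φ x y = A * x ^ 2 + B * x * y + C * y ^ 2 := by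
  obtain ⟨hdet, htr⟩ := h
  rw [det_fin_two] at hdet
  obtain ⟨g, hg⟩ : ∃ g, g = Int.gcd (φ 0 1) (Int.gcd (φ 1 0) (φ 1 1 - φ 0 0)) := ⟨_, rfl⟩
  have hb : (g : ℤ) ∣ φ 0 1 := hg ▸ Int.gcd_dvd_left ..
  have hr : (g : ℤ) ∣ (Int.gcd (φ 1 0) (φ 1 1 - φ 0 0) : ℤ) := hg ▸ Int.gcd_dvd_right ..
  obtain ⟨b, hb⟩ := hb
  obtain ⟨c, hc⟩ := hr.trans (Int.gcd_dvd_left ..)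
  obtain ⟨e, he⟩ := hr.trans (Int.gcd_dvd_right ..)
  have hgD : 0 < (g : ℤ) ^ 2 * (e ^ 2 + 4 * c * b) := by
    have : 2 ^ 2 < (φ 0 0 + φ 1 1) ^ 2 := sq_lt_sq.2 (by simpa using htr)
    linear_combination this + 4 * hdet + (φ 1 1 - φ 0 0 + g * e) * he
      + 4 * φ 1 0 * hb + 4 * g * b * hc
  have hg0 : (0 : ℤ) < g := by
    rcases Nat.eq_zero_or_pos g with h | h
    · simp [h] at hgD
    · exact_mod_cast h
  obtain ⟨ε, hε, hεt, hεs⟩ : ∃ ε : ℤ, (ε = 1 ∨ ε = -1) ∧ 0 < ε * (φ 0 0 + φ 1 1) ∧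
      (φ 0 0 + φ 1 1).sign = ε := by
    rcases lt_abs.1 htr with h | h
    · exact ⟨1, .inl rfl, by linarith, Int.sign_eq_one_of_pos (by linarith)⟩
    · exact ⟨-1, .inr rfl, by linarith, Int.sign_eq_neg_one_of_neg (by linarith)⟩
  have hε2 : ε * ε = 1 := by rcases hε with rfl | rfl <;> rfl
  refine ⟨ε * c, ε * e, -(ε * b), ε * φ 0 0, g, ε, hε, ?_, ⟨?_, ?_, hg0⟩, ?_, fun x y => ?_⟩
  · have : 0 < e ^ 2 + 4 * c * b := pos_of_mul_pos_right hgD (by positivity)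
    linear_combination this + (-(e ^ 2 + 4 * c * b)) * hε2
  · linear_combination hε2 * ((φ 0 0) ^ 2 + φ 0 0 * g * e - c * b * g ^ 2) + hdet
      - φ 0 0 * he + φ 1 0 * hb + g * b * hc
  · linear_combination hεt + ε * he
  · ext i j
    fin_cases i <;> fin_cases j <;> simp [formMatrix]
    · linear_combination (-φ 0 0) * hε2
    · linear_combination hb - g * b * hε2
    · linear_combination hc - g * c * hε2
    · linear_combination he - (φ 0 0 + g * e) * hε2
  · rw [matQ, matU, hεs, ← hg]
    refine Int.ediv_eq_of_eq_mul_right ?_ ?_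
    · rcases hε with rfl | rfl <;> simpa using hg0.ne'
    · rw [hb, hc, he]
      linear_combination (-(g * (c * x ^ 2 + e * x * y - b * y ^ 2))) * hε2

theorem coeff_eq_of_forall_eq {A B C A' B' C' : ℤ}
    (h : ∀ x y : ℤ, A * x ^ 2 + B * x * y + C * y ^ 2 = A' * x ^ 2 + B' * x * y + C' * y ^ 2) :
    A = A' ∧ B = B' ∧ C = C' := by
  have h10 := h 1 0
  have h01 := h 0 1
  have h11 := h 1 1
  refine ⟨?_, ?_, ?_⟩ <;> linarith

/-- If `Q_{φ₁}` and `Q_{φ₂}` are `SL₂(ℤ)`-equivalent, then `φ₁` and `φ₂` are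
`SL₂(ℤ)`-conjugate to `±α^m` and `±α^n` for a common `α ∈ SL₂(ℤ)` and `m, n > 0`. -/
theorem stmt8 (φ₁ φ₂ : Matrix (Fin 2) (Fin 2) ℤ)
    (h₁ : IsAnosov φ₁) (h₂ : IsAnosov φ₂)
    (heq : ∃ A : Matrix (Fin 2) (Fin 2) ℤ, A.det = 1 ∧
      ∀ x y : ℤ, matQ φ₁ x y = matQ φ₂ (x * A 0 0 + y * A 1 0) (x * A 0 1 + y * A 1 1)) :
    ∃ α : Matrix (Fin 2) (Fin 2) ℤ, α.det = 1 ∧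
      ∃ m n : ℕ, 0 < m ∧ 0 < n ∧
        ∃ ε₁ ε₂ : ℤ, (ε₁ = 1 ∨ ε₁ = -1) ∧ (ε₂ = 1 ∨ ε₂ = -1) ∧
          ∃ P₁ P₂ : Matrix (Fin 2) (Fin 2) ℤ, P₁.det = 1 ∧ P₂.det = 1 ∧
            φ₁ * P₁ = P₁ * (ε₁ • α ^ m) ∧ φ₂ * P₂ = P₂ * (ε₂ • α ^ n) := by
  obtain ⟨T, hT, hQ⟩ := heq
  obtain ⟨A, B, C, s₁, u₁, ε₁, hε₁, hD, hU₁, rfl, hQ₁⟩ := h₁.exists_formMatrix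
  obtain ⟨A', B', C', s₂, u₂, ε₂, hε₂, -, ⟨det_eq, tr_pos, u_pos⟩, rfl, hQ₂⟩ :=
    h₂.exists_formMatrix
  obtain ⟨α, hα, hgen⟩ := exists_generator hD ⟨s₁, u₁, hU₁⟩
  simp only [hQ₁, hQ₂] at hQ
  rw [det_fin_two] at hT
  generalize T 0 0 = p at hT hQ
  generalize T 0 1 = q at hT hQ
  generalize T 1 0 = r at hT hQ
  generalize T 1 1 = w at hT hQ
  obtain ⟨hA, hB, hC⟩ := coeff_eq_of_forall_eq
    (A' := A' * p ^ 2 + B' * p * q + C' * q ^ 2)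
    (B' := 2 * A' * p * r + B' * (p * w + q * r) + 2 * C' * q * w)
    (C' := A' * r ^ 2 + B' * r * w + C' * w ^ 2)
    fun x y => (hQ x y).trans (by ring)
  obtain ⟨k, hk⟩ : ∃ k, k = -(w * C' * q) - r * (A' * p + B' * q) := ⟨_, rfl⟩
  have htr : 2 * k + B = B' := by
    rw [hB, hk]; linear_combination B' * hT
  have hdet : k ^ 2 + k * B + A * C = A' * C' := by
    rw [hA, hB, hC, hk]; linear_combination A' * C' * (p * w - q * r + 1) * hT
  obtain ⟨m, hm⟩ := hgen s₁ u₁ hU₁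
  obtain ⟨n, hn⟩ := hgen (s₂ + u₂ * k) u₂ ⟨by
    linear_combination det_eq + s₂ * u₂ * htr + u₂ ^ 2 * hdet, by
    linear_combination tr_pos + (-u₂) * htr, u_pos⟩
  refine ⟨α, hα, m + 1, n + 1, m.succ_pos, n.succ_pos, ε₁, ε₂, hε₁, hε₂, 1, !![p, r; q, w],
    det_one, ?_, ?_, ?_⟩
  · rw [det_fin_two_of]; linear_combination hT
  · rw [hm, mul_one, one_mul]
  · rw [← hn, smul_mul_assoc, mul_smul_comm]
    congr 1
    ext i j
    fin_cases i <;> fin_cases j <;> simp [formMatrix, mul_apply, Fin.sum_univ_two] <;>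
      rw [hk] <;> (try rw [hA]) <;> (try rw [hB]) <;> (try rw [hC])
    · linear_combination (u₂ * C' * q) * hT
    · linear_combination (u₂ * C' * w) * hT
    · linear_combination (-u₂ * (A' * p + B' * q)) * hT
    · linear_combination (-u₂ * (A' * r + B' * w)) * hT
end

section
/- Let φ, ψ ∈ SL₂(ℤ) be Anosov matrices with D_φ = D_ψ and tr(φ) = tr(ψ), and suppose there exists B ∈ GL₂(ℤ) (det B = ±1) such that Q_φ(x, y) = Q_ψ((x, y)·B) for all integers x, y. Then φ is SL₂(ℤ)-conjugate to ψ or to w·ψ⁻¹·w, where w = !![0, 1; 1, 0]. -/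
open Matrix

/-- The numerator of `matQ φ`, evaluated at a column vector `v`, is `det (v, φ v)`. -/
def fixForm (φ : Matrix (Fin 2) (Fin 2) ℤ) (x y : ℤ) : ℤ :=
  φ 1 0 * x ^ 2 + (φ 1 1 - φ 0 0) * x * y - φ 0 1 * y ^ 2

lemma matU_dvd_s10 {φ : Matrix (Fin 2) (Fin 2) ℤ} (hφ : φ 0 0 + φ 1 1 ≠ 0) :
    matU φ ∣ φ 0 1 ∧ matU φ ∣ φ 1 0 ∧ matU φ ∣ φ 1 1 - φ 0 0 := by
  rcases lt_trichotomy (φ 0 0 + φ 1 1) 0 with h | h | h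
  · have hU : matU φ = -(Int.gcd (φ 0 1) (Int.gcd (φ 1 0) (φ 1 1 - φ 0 0)) : ℤ) := by
      rw [matU, Int.sign_eq_neg_one_of_neg h, neg_one_mul]
    rw [hU, neg_dvd, neg_dvd, neg_dvd]
    have h2 := Int.gcd_dvd_right (φ 0 1) (Int.gcd (φ 1 0) (φ 1 1 - φ 0 0))
    exact ⟨Int.gcd_dvd_left _ _, h2.trans (Int.gcd_dvd_left _ _), h2.trans (Int.gcd_dvd_right _ _)⟩
  · exact absurd h hφ
  · have hU : matU φ = (Int.gcd (φ 0 1) (Int.gcd (φ 1 0) (φ 1 1 - φ 0 0)) : ℤ) := by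
      rw [matU, Int.sign_eq_one_of_pos h, one_mul]
    rw [hU]
    have h2 := Int.gcd_dvd_right (φ 0 1) (Int.gcd (φ 1 0) (φ 1 1 - φ 0 0))
    exact ⟨Int.gcd_dvd_left _ _, h2.trans (Int.gcd_dvd_left _ _), h2.trans (Int.gcd_dvd_right _ _)⟩

lemma IsAnosov.trace_ne_zero {φ : Matrix (Fin 2) (Fin 2) ℤ} (hφ : IsAnosov φ) :
    φ 0 0 + φ 1 1 ≠ 0 := by
  intro h
  have := hφ.2
  rw [h] at this
  norm_num at this

lemma IsAnosov.trace_sq_sub_four_pos {φ : Matrix (Fin 2) (Fin 2) ℤ} (hφ : IsAnosov φ) :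
    0 < (φ 0 0 + φ 1 1) ^ 2 - 4 := by
  have h := hφ.2
  rw [← sq_abs]
  nlinarith

lemma IsAnosov.matD_mul_matU_sq {φ : Matrix (Fin 2) (Fin 2) ℤ} (hφ : IsAnosov φ) :
    matD φ * matU φ ^ 2 = (φ 0 0 + φ 1 1) ^ 2 - 4 := by
  apply Int.ediv_mul_cancel
  obtain ⟨⟨b, hb⟩, ⟨c, hc⟩, ⟨e, he⟩⟩ := matU_dvd_s10 hφ.trace_ne_zero
  have hdet := hφ.1
  rw [det_fin_two] at hdet
  exact ⟨e ^ 2 + 4 * b * c, by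
    linear_combination 4 * hdet + 4 * φ 1 0 * hb + 4 * matU φ * b * hc +
      (φ 1 1 - φ 0 0 + matU φ * e) * he⟩

lemma IsAnosov.matQ_mul_matU {φ : Matrix (Fin 2) (Fin 2) ℤ} (hφ : IsAnosov φ) (x y : ℤ) :
    matQ φ x y * matU φ = fixForm φ x y := by
  obtain ⟨hb, hc, he⟩ := matU_dvd_s10 hφ.trace_ne_zero
  exact Int.ediv_mul_cancel
    (dvd_sub (dvd_add (hc.mul_right _) ((he.mul_right _).mul_right _)) (hb.mul_right _))

lemma IsAnosov.matU_eq {φ ψ : Matrix (Fin 2) (Fin 2) ℤ} (hφ : IsAnosov φ) (hψ : IsAnosov ψ)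
    (hD : matD φ = matD ψ) (htr : φ 0 0 + φ 1 1 = ψ 0 0 + ψ 1 1) : matU φ = matU ψ := by
  have hpos := hφ.trace_sq_sub_four_pos
  have h1 := hφ.matD_mul_matU_sq
  have h2 := hψ.matD_mul_matU_sq
  have hD0 : matD φ ≠ 0 := by
    intro h
    rw [← h1, h, zero_mul] at hpos
    exact lt_irrefl _ hpos
  rw [← htr, ← h1, ← hD] at h2
  have hsq := mul_left_cancel₀ hD0 h2
  have hs : (ψ 0 0 + ψ 1 1).sign ^ 2 ≠ 0 :=
    pow_ne_zero _ (by simpa [Int.sign_eq_zero_iff_zero] using hψ.trace_ne_zero)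
  unfold matU at hsq ⊢
  rw [htr, mul_pow, mul_pow] at hsq
  rw [htr, (pow_left_inj₀ (by positivity) (by positivity) two_ne_zero).1
    (mul_left_cancel₀ hs hsq)]

lemma ext_fin_two_of {a b c d a' b' c' d' : ℤ} (ha : a = a') (hb : b = b') (hc : c = c')
    (hd : d = d') : !![a, b; c, d] = !![a', b'; c', d'] := by
  rw [ha, hb, hc, hd]

/-- Anosov matrices with the same discriminant and trace whose forms are
`GL₂(ℤ)`-equivalent are `SL₂(ℤ)`-conjugate up to `ψ ↦ wψ⁻¹w`. -/
theorem stmt10 (φ ψ : Matrix (Fin 2) (Fin 2) ℤ)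
    (hφ : IsAnosov φ) (hψ : IsAnosov ψ)
    (hD : matD φ = matD ψ)
    (htr : φ 0 0 + φ 1 1 = ψ 0 0 + ψ 1 1)
    (heq : ∃ B : Matrix (Fin 2) (Fin 2) ℤ, (B.det = 1 ∨ B.det = -1) ∧
      ∀ x y : ℤ, matQ φ x y = matQ ψ (x * B 0 0 + y * B 1 0) (x * B 0 1 + y * B 1 1)) :
    ∃ P : Matrix (Fin 2) (Fin 2) ℤ, P.det = 1 ∧
      (φ * P = P * ψ ∨ φ * P = P * (!![0, 1; 1, 0] * inv2 ψ * !![0, 1; 1, 0])) := by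
  obtain ⟨B, hB, hQ⟩ := heq
  have hF (x y : ℤ) : fixForm φ x y =
      fixForm ψ (x * B 0 0 + y * B 1 0) (x * B 0 1 + y * B 1 1) := by
    rw [← hφ.matQ_mul_matU, ← hψ.matQ_mul_matU, hQ, hφ.matU_eq hψ hD htr]
  have h10 := hF 1 0
  have h01 := hF 0 1
  have h11 := hF 1 1
  simp only [fixForm] at h10 h01 h11
  ring_nf at h10 h01 h11
  rw [det_fin_two] at hB
  generalize B 0 0 = p at *
  generalize B 0 1 = q at *
  generalize B 1 0 = r at *
  generalize B 1 1 = s at *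
  generalize ha : φ 0 0 = a at *
  generalize hb : φ 0 1 = b at *
  generalize hc : φ 1 0 = c at *
  generalize hd : φ 1 1 = d at *
  have hφe : φ = !![a, b; c, d] := by rw [← ha, ← hb, ← hc, ← hd]; exact eta_fin_two φ
  generalize ha' : ψ 0 0 = a' at *
  generalize hb' : ψ 0 1 = b' at *
  generalize hc' : ψ 1 0 = c' at *
  generalize hd' : ψ 1 1 = d' at *
  have hψe : ψ = !![a', b'; c', d'] := by rw [← ha', ← hb', ← hc', ← hd']; exact eta_fin_two ψ
  rcases hB with hB | hB
  · refine ⟨!![s, -r; -q, p], by rw [det_fin_two_of]; linear_combination hB, Or.inl ?_⟩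
    have ea : a = s * (a' * p + b' * q) - r * (c' * p + d' * q) := by
      linarith [congrArg ((a' + d') * ·) hB]
    have eb : b = s * (a' * r + b' * s) - r * (c' * r + d' * s) := by linarith
    have ec : c = p * (c' * p + d' * q) - q * (a' * p + b' * q) := by linarith
    have ed : d = p * (c' * r + d' * s) - q * (a' * r + b' * s) := by
      linarith [congrArg ((a' + d') * ·) hB]
    rw [hφe, hψe, mul_fin_two, mul_fin_two]
    apply ext_fin_two_of
    · linear_combination s * ea - q * eb + (s * a' - r * c') * hB
    · linear_combination -r * ea + p * eb + (s * b' - r * d') * hB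
    · linear_combination s * ec - q * ed + (p * c' - q * a') * hB
    · linear_combination -r * ec + p * ed + (p * d' - q * b') * hB
  · refine ⟨!![r, -s; -p, q], by rw [det_fin_two_of]; linear_combination -hB, Or.inr ?_⟩
    have ea : a = r * (a' * q - c' * p) - s * (d' * p - b' * q) := by
      linarith [congrArg ((a' + d') * ·) hB]
    have eb : b = r * (a' * s - c' * r) - s * (d' * r - b' * s) := by linarith
    have ec : c = q * (d' * p - b' * q) - p * (a' * q - c' * p) := by linarith
    have ed : d = q * (d' * r - b' * s) - p * (a' * s - c' * r) := by
      linarith [congrArg ((a' + d') * ·) hB]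
    have hw : !![0, 1; 1, 0] * inv2 ψ * !![0, 1; 1, 0] = !![a', -c'; -b', d'] := by
      simp [inv2, hψe]
    rw [hw, hφe, mul_fin_two, mul_fin_two]
    apply ext_fin_two_of
    · linear_combination r * ea - p * eb - (r * a' + s * b') * hB
    · linear_combination -s * ea + q * eb + (r * c' + s * d') * hB
    · linear_combination r * ec - p * ed + (p * a' + q * b') * hB
    · linear_combination -s * ec + q * ed - (p * c' + q * d') * hB
end

section
/- Let D be a nonsquare positive integer with D ≡ 0 or 1 (mod 4). Then the negative Pell equation x² − D·y² = −4 has an integer solution if and only if there exists ψ ∈ GL₂(ℤ) with det ψ = −1 and tr ψ ≠ 0 such that ψ² is Anosov and D_{ψ²} = D. (This is the algebraic content of: x² − Dy² = −4 is solvable if and only if there is a non-orientable Sol torus bundle whose orientable double cover has discriminant D.) -/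
open Matrix

lemma sq_eq_of_det_eq_neg_one {ψ : Matrix (Fin 2) (Fin 2) ℤ} (h : ψ.det = -1) :
    ψ ^ 2 = !![(ψ 0 0 + ψ 1 1) * ψ 0 0 + 1, (ψ 0 0 + ψ 1 1) * ψ 0 1;
      (ψ 0 0 + ψ 1 1) * ψ 1 0, (ψ 0 0 + ψ 1 1) * ψ 1 1 + 1] := by
  rw [Matrix.det_fin_two] at h
  ext i j
  fin_cases i <;> fin_cases j <;> simp [pow_two, Matrix.mul_apply, Fin.sum_univ_two] <;>
    linarith

lemma matU_sq_sq {ψ : Matrix (Fin 2) (Fin 2) ℤ} (h : ψ.det = -1) :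
    matU (ψ ^ 2) ^ 2 = (ψ 0 0 + ψ 1 1) ^ 2 *
      (Int.gcd (ψ 0 1) (Int.gcd (ψ 1 0) (ψ 1 1 - ψ 0 0)) : ℤ) ^ 2 := by
  rw [sq_eq_of_det_eq_neg_one h]
  have hd : ∀ t : ℤ, t * ψ 1 1 + 1 - (t * ψ 0 0 + 1) = t * (ψ 1 1 - ψ 0 0) := fun t => by ring
  have hs : ((ψ 0 0 + ψ 1 1) * ψ 0 0 + 1 + ((ψ 0 0 + ψ 1 1) * ψ 1 1 + 1)).sign = 1 :=
    Int.sign_eq_one_of_pos (by nlinarith [sq_nonneg (ψ 0 0 + ψ 1 1)])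
  have hg : ∀ t a b c : ℤ, (Int.gcd (t * a) (Int.gcd (t * b) (t * c)) : ℤ) =
      |t| * (Int.gcd a (Int.gcd b c) : ℤ) := fun t a b c => by
    rw [Int.gcd_mul_left t b c, Int.gcd_def, Int.natAbs_mul, Int.natAbs_natCast, Nat.gcd_mul_left,
      Nat.cast_mul, Int.natCast_natAbs, Int.gcd_def a, Int.natAbs_natCast]
  simp only [matU, Matrix.of_apply, Matrix.cons_val', Matrix.cons_val_zero, Matrix.cons_val_one,
    Matrix.cons_val_fin_one, hd, hs, hg, one_mul, mul_pow, sq_abs]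

lemma trace_sq_of_det_eq_neg_one {ψ : Matrix (Fin 2) (Fin 2) ℤ} (h : ψ.det = -1) :
    (ψ ^ 2) 0 0 + (ψ ^ 2) 1 1 = (ψ 0 0 + ψ 1 1) ^ 2 + 2 := by
  rw [sq_eq_of_det_eq_neg_one h]
  simp
  ring

/-- For `ψ` of determinant `-1` and nonzero trace, with `g = gcd(b, c, d - a)`, the discriminant
`D` of `ψ ^ 2` satisfies `tr ψ ^ 2 + 4 = D * g ^ 2`. -/
lemma matD_sq_mul {ψ : Matrix (Fin 2) (Fin 2) ℤ} (h : ψ.det = -1) (ht : ψ 0 0 + ψ 1 1 ≠ 0) :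
    (ψ 0 0 + ψ 1 1) ^ 2 + 4 = matD (ψ ^ 2) *
      (Int.gcd (ψ 0 1) (Int.gcd (ψ 1 0) (ψ 1 1 - ψ 0 0)) : ℤ) ^ 2 := by
  rw [matD, matU_sq_sq h, trace_sq_of_det_eq_neg_one h]
  rw [Matrix.det_fin_two] at h
  set g : ℤ := (Int.gcd (ψ 0 1) (Int.gcd (ψ 1 0) (ψ 1 1 - ψ 0 0)) : ℤ)
  have hq : g ∣ ψ 0 1 := Int.gcd_dvd_left ..
  have hrs : g ∣ (Int.gcd (ψ 1 0) (ψ 1 1 - ψ 0 0) : ℤ) := Int.gcd_dvd_right ..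
  have hr : g ∣ ψ 1 0 := hrs.trans (Int.gcd_dvd_left ..)
  have hs : g ∣ ψ 1 1 - ψ 0 0 := hrs.trans (Int.gcd_dvd_right ..)
  have hdvd : g ^ 2 ∣ (ψ 0 0 + ψ 1 1) ^ 2 + 4 := by
    have e : (ψ 0 0 + ψ 1 1) ^ 2 + 4 = (ψ 1 1 - ψ 0 0) ^ 2 + 4 * (ψ 0 1 * ψ 1 0) := by
      linear_combination 4 * h
    rw [e]
    exact dvd_add (pow_dvd_pow_of_dvd hs 2) ((pow_two g ▸ mul_dvd_mul hq hr).mul_left 4)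
  rw [show ((ψ 0 0 + ψ 1 1) ^ 2 + 2) ^ 2 - 4 =
    (ψ 0 0 + ψ 1 1) ^ 2 * ((ψ 0 0 + ψ 1 1) ^ 2 + 4) by ring,
    Int.mul_ediv_mul_of_pos _ _ (by positivity), Int.ediv_mul_cancel hdvd]

/-- A solution of `x ^ 2 - D * y ^ 2 = -4` is realised by a matrix of determinant `-1` and
trace `x` whose gcd `gcd(b, c, d - a)` is `|y|`. -/
lemma exists_matrix_of_negPell {D x y : ℤ} (hmod : D % 4 = 0 ∨ D % 4 = 1)
    (h : x ^ 2 - D * y ^ 2 = -4) :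
    ∃ ψ : Matrix (Fin 2) (Fin 2) ℤ, ψ.det = -1 ∧ ψ 0 0 + ψ 1 1 = x ∧
      (Int.gcd (ψ 0 1) (Int.gcd (ψ 1 0) (ψ 1 1 - ψ 0 0)) : ℤ) = |y| := by
  obtain ⟨k, m, hD⟩ : ∃ k m : ℤ, D = k ^ 2 + 4 * m := by
    rcases hmod with h0 | h1
    · exact ⟨0, D / 4, by omega⟩
    · exact ⟨1, D / 4, by omega⟩
  obtain ⟨p, hp⟩ : ∃ p, x = y * k + 2 * p := by
    have hev : Even ((x - y * k) ^ 2) :=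
      ⟨2 * m * y ^ 2 - 2 + y ^ 2 * k ^ 2 - x * y * k, by rw [hD] at h; linear_combination h⟩
    obtain ⟨p, hp⟩ := (Int.even_pow.1 hev).1
    exact ⟨p, by linarith⟩
  refine ⟨!![p, y; y * m, p + y * k], ?_, ?_, ?_⟩
  · rw [Matrix.det_fin_two_of]
    subst hp hD
    linarith
  · simp [hp]; ring
  · have hdvd : y ∣ (Int.gcd (y * m) (y * k) : ℤ) :=
      Int.dvd_coe_gcd (dvd_mul_right ..) (dvd_mul_right ..)
    simp only [Matrix.of_apply, Matrix.cons_val', Matrix.cons_val_zero, Matrix.cons_val_one,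
      Matrix.cons_val_fin_one, add_sub_cancel_left]
    rw [← Int.natAbs_dvd_natAbs, Int.natAbs_natCast] at hdvd
    rw [Int.gcd_def, Int.natAbs_natCast, Nat.gcd_eq_left hdvd, Int.natCast_natAbs]

lemma ne_zero_of_negPell {D x y : ℤ} (hns : ¬ IsSquare D) (h : x ^ 2 - D * y ^ 2 = -4) :
    x ≠ 0 := by
  rintro rfl
  have h4 : D * y ^ 2 = 2 ^ 2 := by linarith
  obtain ⟨k, hk⟩ := (Int.pow_dvd_pow_iff two_ne_zero).1 (Dvd.intro_left D h4)
  have hy : y ≠ 0 := by rintro rfl; simp at h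
  refine hns ⟨k, mul_right_cancel₀ (pow_ne_zero 2 hy) ?_⟩
  rw [h4, hk]
  ring

/-- `x² − Dy² = −4` is solvable iff there is `ψ ∈ GL₂(ℤ)` with `det ψ = −1`,
`tr ψ ≠ 0`, such that `ψ²` is Anosov with discriminant `D`. -/
theorem stmt12 (D : ℤ) (hpos : 0 < D) (hns : ¬ IsSquare D)
    (hmod : D % 4 = 0 ∨ D % 4 = 1) :
    (∃ x y : ℤ, x ^ 2 - D * y ^ 2 = -4) ↔
      ∃ ψ : Matrix (Fin 2) (Fin 2) ℤ, ψ.det = -1 ∧ ψ 0 0 + ψ 1 1 ≠ 0 ∧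
        (ψ ^ 2).det = 1 ∧ 2 < |(ψ ^ 2) 0 0 + (ψ ^ 2) 1 1| ∧ matD (ψ ^ 2) = D := by
  constructor
  · rintro ⟨x, y, h⟩
    obtain ⟨ψ, hdet, htr, hg⟩ := exists_matrix_of_negPell hmod h
    have hx := ne_zero_of_negPell hns h
    have ht : ψ 0 0 + ψ 1 1 ≠ 0 := htr ▸ hx
    refine ⟨ψ, hdet, ht, by rw [Matrix.det_pow, hdet]; norm_num, ?_, ?_⟩
    · rw [trace_sq_of_det_eq_neg_one hdet]
      exact lt_of_lt_of_le (lt_add_of_pos_left 2 (by positivity)) (le_abs_self _)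
    · have hD := matD_sq_mul hdet ht
      rw [htr, hg, sq_abs] at hD
      have hy : y ≠ 0 := by rintro rfl; nlinarith
      exact mul_right_cancel₀ (pow_ne_zero 2 hy) (by linarith)
  · rintro ⟨ψ, hdet, ht, -, -, rfl⟩
    exact ⟨ψ 0 0 + ψ 1 1, (Int.gcd (ψ 0 1) (Int.gcd (ψ 1 0) (ψ 1 1 - ψ 0 0)) : ℤ), by
      linear_combination matD_sq_mul hdet ht⟩
end

section
/- Let D be a nonsquare positive integer with D ≡ 0 or 1 (mod 4). Then the negative Pell equation x² − D·y² = −4 has an integer solution if and only if there exist integers a, b, c with a·b·c ≠ 0 and a² + b·c = −1 (so that ψ = !![a, b; c, −a] ∈ SL₂(ℤ) has trace 0) such that −4·b·c / gcd(b, c)² = lcm(D, 4). (This is the algebraic content of: x² − Dy² = −4 is solvable if and only if there is an achiral torus semi-bundle whose torus bundle double cover has discriminant lcm(D, 4).) -/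
/-- The equation `u² − Nv² = −1` is solvable iff some trace-zero matrix
`!![a, b; c, −a]` of determinant one with `abc ≠ 0` has discriminant `4N`. -/
theorem exists_sq_sub_mul_sq_eq_neg_one_iff {N : ℤ} (hpos : 0 < N) (hns : ¬ IsSquare N) :
    (∃ u v : ℤ, u ^ 2 - N * v ^ 2 = -1) ↔
      ∃ a b c : ℤ, a * b * c ≠ 0 ∧ a ^ 2 + b * c = -1 ∧
        -4 * b * c / (Int.gcd b c : ℤ) ^ 2 = 4 * N := by
  constructor
  · rintro ⟨u, v, h⟩
    have hv : v ≠ 0 := by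
      rintro rfl
      nlinarith [sq_nonneg u]
    have hu : u ≠ 0 := by
      rintro rfl
      have hN : N = 1 := Int.eq_one_of_dvd_one hpos.le ⟨v ^ 2, by linarith⟩
      exact hns (hN ▸ IsSquare.one)
    have hgcd : (Int.gcd v (-(N * v)) : ℤ) = |v| := by
      rw [Int.gcd_eq_natAbs_left (by simp), Int.natCast_natAbs]
    refine ⟨u, v, -(N * v), by simp [hu, hv, hpos.ne'], by linear_combination h, ?_⟩
    rw [hgcd, sq_abs, show -4 * v * -(N * v) = 4 * N * v ^ 2 by ring]
    exact Int.mul_ediv_cancel _ (pow_ne_zero 2 hv)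
  · rintro ⟨a, b, c, -, hdet, hdisc⟩
    have hdvd : (Int.gcd b c : ℤ) ^ 2 ∣ -4 * b * c := by
      rw [sq]
      exact mul_dvd_mul ((Int.gcd_dvd_left _ _).mul_left _) (Int.gcd_dvd_right _ _)
    have h := Int.ediv_mul_cancel hdvd
    rw [hdisc] at h
    exact ⟨a, Int.gcd b c, by linarith⟩

/-- For odd `D`, the norm equations for `−4` and `−1` are simultaneously solvable:
a solution with `x` odd becomes integral after cubing `(x + y√D) / 2`. -/
theorem exists_sq_sub_mul_sq_eq_neg_four_iff_of_odd {D : ℤ} (hD : Odd D) :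
    (∃ x y : ℤ, x ^ 2 - D * y ^ 2 = -4) ↔ ∃ u v : ℤ, u ^ 2 - D * v ^ 2 = -1 := by
  constructor
  · rintro ⟨x, y, h⟩
    rcases Int.even_or_odd' x with ⟨k, rfl | rfl⟩
    · have hy : Even y := by
        have : Even (D * y ^ 2) := ⟨2 * k ^ 2 + 2, by linarith⟩
        rcases Int.even_mul.mp this with h' | h'
        · exact absurd h' (Int.not_even_iff_odd.mpr hD)
        · exact (Int.even_pow.mp h').1
      obtain ⟨m, rfl⟩ := hy
      exact ⟨k, m, by linarith⟩
    · refine ⟨(2 * k + 1) * (2 * k ^ 2 + 2 * k + 2), y * (2 * k ^ 2 + 2 * k + 1), ?_⟩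
      linear_combination (2 * k ^ 2 + 2 * k + 1) ^ 2 * h
  · rintro ⟨u, v, h⟩
    exact ⟨2 * u, 2 * v, by linear_combination 4 * h⟩

theorem exists_sq_sub_four_mul_sq_eq_neg_four_iff {N : ℤ} :
    (∃ x y : ℤ, x ^ 2 - 4 * N * y ^ 2 = -4) ↔ ∃ u v : ℤ, u ^ 2 - N * v ^ 2 = -1 := by
  constructor
  · rintro ⟨x, y, h⟩
    have hx : Even (x ^ 2) := ⟨2 * N * y ^ 2 - 2, by linarith⟩
    obtain ⟨k, rfl⟩ := (Int.even_pow.mp hx).1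
    exact ⟨k, y, by linarith⟩
  · rintro ⟨u, v, h⟩
    exact ⟨2 * u, v, by linear_combination 4 * h⟩

/-- `x² − Dy² = −4` is solvable iff there are integers `a, b, c` with `abc ≠ 0`,
`a² + bc = −1`, and `−4bc/gcd(b,c)² = lcm(D, 4)`. -/
theorem stmt13 (D : ℤ) (hpos : 0 < D) (hns : ¬ IsSquare D)
    (hmod : D % 4 = 0 ∨ D % 4 = 1) :
    (∃ x y : ℤ, x ^ 2 - D * y ^ 2 = -4) ↔
      ∃ a b c : ℤ, a * b * c ≠ 0 ∧ a ^ 2 + b * c = -1 ∧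
        -4 * b * c / (Int.gcd b c : ℤ) ^ 2 = (Int.lcm D 4 : ℤ) := by
  rcases hmod with h | h
  · obtain ⟨N, rfl⟩ := Int.dvd_of_emod_eq_zero h
    have hN : 0 < N := by linarith
    have hNs : ¬ IsSquare N := by
      rintro ⟨r, rfl⟩
      exact hns ⟨2 * r, by ring⟩
    have hlcm : (Int.lcm (4 * N) 4 : ℤ) = 4 * N := by
      exact Int.lcm_eq_left hpos.le (Int.dvd_mul_right 4 N)
    rw [hlcm, exists_sq_sub_four_mul_sq_eq_neg_four_iff,
      exists_sq_sub_mul_sq_eq_neg_one_iff hN hNs]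
  · have hodd : Odd D := Int.odd_iff.mpr (by lia)
    have hlcm : (Int.lcm D 4 : ℤ) = 4 * D := by
      have hcop : Int.gcd D 4 = 1 :=
        Int.isCoprime_iff_gcd_eq_one.mp ⟨1, -(D / 4), by lia⟩
      have hmul := Int.gcd_mul_lcm D 4
      rw [hcop, one_mul] at hmul
      rw [hmul, Nat.cast_mul, Int.natAbs_of_nonneg hpos.le, mul_comm]
      rfl
    rw [hlcm, exists_sq_sub_mul_sq_eq_neg_four_iff_of_odd hodd,
      exists_sq_sub_mul_sq_eq_neg_one_iff hpos hns]
end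

section
/- Let φ ∈ SL₂(ℤ) be Anosov. Then there exists A ∈ GL₂(ℤ) with det A = −1 and A·φ = φ⁻¹·A if and only if there exists B ∈ GL₂(ℤ) with det B = −1 such that Q_φ((x, y)·B) = Q_φ(x, y) for all integers x, y. (This is the statement that such an anti-conjugating A of determinant −1 exists if and only if 2[Q_φ] = 0 in the class group C(D_φ).) -/
open Matrix

/-- The integer form `c·x² + (d − a)·x·y − b·y²`, which `matQ φ` divides by `matU φ`. -/
def matForm (φ : Matrix (Fin 2) (Fin 2) ℤ) (x y : ℤ) : ℤ :=
  φ 1 0 * x ^ 2 + (φ 1 1 - φ 0 0) * x * y - φ 0 1 * y ^ 2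

theorem offDiag_ne_zero_of_two_lt_abs_trace {φ : Matrix (Fin 2) (Fin 2) ℤ} (hdet : φ.det = 1)
    (han : 2 < |φ 0 0 + φ 1 1|) :
    φ 0 1 ≠ 0 ∨ φ 1 0 ≠ 0 := by
  by_contra! h
  obtain ⟨hb, hc⟩ := h
  rw [det_fin_two, hb, hc] at hdet
  have had : φ 0 0 * φ 1 1 = 1 := by linarith
  rcases Int.mul_eq_one_iff_eq_one_or_neg_one.mp had with ⟨ha, hd⟩ | ⟨ha, hd⟩ <;>
    norm_num [ha, hd] at han

theorem matU_dvd_of_gcd_dvd {φ : Matrix (Fin 2) (Fin 2) ℤ} (htr : φ 0 0 + φ 1 1 ≠ 0) {n : ℤ}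
    (h : (Int.gcd (φ 0 1) (Int.gcd (φ 1 0) (φ 1 1 - φ 0 0)) : ℤ) ∣ n) :
    matU φ ∣ n := by
  unfold matU
  rcases lt_or_gt_of_ne htr with ht | ht
  · simpa [Int.sign_eq_neg_one_of_neg ht] using h
  · simpa [Int.sign_eq_one_of_pos ht] using h

theorem matU_dvd_matForm {φ : Matrix (Fin 2) (Fin 2) ℤ} (htr : φ 0 0 + φ 1 1 ≠ 0) (x y : ℤ) :
    matU φ ∣ matForm φ x y := by
  refine matU_dvd_of_gcd_dvd htr ?_
  have hb := Int.gcd_dvd_left (φ 0 1) (Int.gcd (φ 1 0) (φ 1 1 - φ 0 0))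
  have hg := Int.gcd_dvd_right (φ 0 1) (Int.gcd (φ 1 0) (φ 1 1 - φ 0 0))
  have hc := hg.trans (Int.gcd_dvd_left (φ 1 0) (φ 1 1 - φ 0 0))
  have he := hg.trans (Int.gcd_dvd_right (φ 1 0) (φ 1 1 - φ 0 0))
  exact dvd_sub (dvd_add (hc.mul_right _) ((he.mul_right _).mul_right _)) (hb.mul_right _)

theorem matQ_eq_matQ_iff {φ : Matrix (Fin 2) (Fin 2) ℤ} (htr : φ 0 0 + φ 1 1 ≠ 0)
    (x y z w : ℤ) :
    matQ φ x y = matQ φ z w ↔ matForm φ x y = matForm φ z w :=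
  Int.ediv_left_inj (matU_dvd_matForm htr x y) (matU_dvd_matForm htr z w)

theorem mul_eq_inv2_mul_iff {φ : Matrix (Fin 2) (Fin 2) ℤ} (hbc : φ 0 1 ≠ 0 ∨ φ 1 0 ≠ 0)
    (A : Matrix (Fin 2) (Fin 2) ℤ) :
    A * φ = inv2 φ * A ↔ A 0 0 + A 1 1 = 0 ∧
      (φ 1 1 - φ 0 0) * A 0 0 = A 0 1 * φ 1 0 + φ 0 1 * A 1 0 := by
  rw [← Matrix.ext_iff]
  simp only [Fin.forall_fin_two, mul_apply, Fin.sum_univ_two, inv2, of_apply, cons_val',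
    cons_val_zero, cons_val_one, cons_val_fin_one]
  constructor
  · rintro ⟨⟨h₀₀, h₀₁⟩, h₁₀, h₁₁⟩
    refine ⟨?_, by linarith⟩
    rcases hbc with hb | hc
    · exact (mul_eq_zero.mp (by linarith : φ 0 1 * (A 0 0 + A 1 1) = 0)).resolve_left hb
    · exact (mul_eq_zero.mp (by linarith : φ 1 0 * (A 0 0 + A 1 1) = 0)).resolve_left hc
  · rintro ⟨ht, he⟩
    refine ⟨⟨?_, ?_⟩, ?_, ?_⟩
    · linear_combination -he
    · linear_combination φ 0 1 * ht
    · linear_combination φ 1 0 * ht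
    · linear_combination (φ 1 1 - φ 0 0) * ht - he

theorem matForm_invariant_iff {φ : Matrix (Fin 2) (Fin 2) ℤ} (hbc : φ 0 1 ≠ 0 ∨ φ 1 0 ≠ 0)
    {B : Matrix (Fin 2) (Fin 2) ℤ} (hB : B.det = -1) :
    (∀ x y : ℤ,
      matForm φ (x * B 0 0 + y * B 1 0) (x * B 0 1 + y * B 1 1) = matForm φ x y) ↔
    B 0 0 + B 1 1 = 0 ∧
      (φ 1 1 - φ 0 0) * B 0 0 = B 1 0 * φ 1 0 + φ 0 1 * B 0 1 := by
  rw [det_fin_two] at hB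
  unfold matForm
  generalize φ 1 1 - φ 0 0 = e
  generalize φ 0 1 = b at *
  generalize φ 1 0 = c at *
  generalize B 0 0 = p at *
  generalize B 1 0 = q at *
  generalize B 0 1 = r at *
  generalize B 1 1 = s at *
  constructor
  · intro h
    have h₁ := h 1 0
    have h₂ := h 0 1
    have h₃ := h 1 1
    ring_nf at h₁ h₂ h₃
    have hE : 2 * c * p * q + e * (p * s + q * r) - 2 * b * r * s = e := by linarith
    have hc : c * (p + s) = 0 := by grind
    have hb : b * (p + s) = 0 := by grind
    refine ⟨?_, by grind⟩
    rcases hbc with hb' | hc'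
    · exact (mul_eq_zero.mp hb).resolve_left hb'
    · exact (mul_eq_zero.mp hc).resolve_left hc'
  · rintro ⟨ht, he⟩ x y
    obtain rfl : s = -p := by linarith
    grind

/-- For Anosov `φ`: an anti-conjugating `A` of determinant `−1` exists iff some
determinant `−1` matrix preserves `Q_φ` (i.e. `2[Q_φ] = 0` in `C(D_φ)`). -/
theorem stmt14 (φ : Matrix (Fin 2) (Fin 2) ℤ) (hdet : φ.det = 1)
    (han : 2 < |φ 0 0 + φ 1 1|) :
    (∃ A : Matrix (Fin 2) (Fin 2) ℤ, A.det = -1 ∧ A * φ = inv2 φ * A) ↔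
      (∃ B : Matrix (Fin 2) (Fin 2) ℤ, B.det = -1 ∧
        ∀ x y : ℤ,
          matQ φ (x * B 0 0 + y * B 1 0) (x * B 0 1 + y * B 1 1) = matQ φ x y) := by
  have htr : φ 0 0 + φ 1 1 ≠ 0 := by
    intro h
    norm_num [h] at han
  have hbc := offDiag_ne_zero_of_two_lt_abs_trace hdet han
  have key (B : Matrix (Fin 2) (Fin 2) ℤ) (hB : B.det = -1) :
      Bᵀ * φ = inv2 φ * Bᵀ ↔ ∀ x y : ℤ,
        matQ φ (x * B 0 0 + y * B 1 0) (x * B 0 1 + y * B 1 1) = matQ φ x y := by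
    simp only [matQ_eq_matQ_iff htr, matForm_invariant_iff hbc hB, mul_eq_inv2_mul_iff hbc,
      transpose_apply]
  constructor
  · rintro ⟨A, hA, h⟩
    have hAt : Aᵀ.det = -1 := by rwa [det_transpose]
    exact ⟨Aᵀ, hAt, (key Aᵀ hAt).mp (by rwa [transpose_transpose])⟩
  · rintro ⟨B, hB, h⟩
    exact ⟨Bᵀ, by rwa [det_transpose], (key B hB).mpr h⟩
end

section
/- The set of positive integers that are sums of two integer squares has natural density zero: lim_{X → ∞} (1/X) · #{n : 0 < n < X and there exist integers a, b with n = a² + b²} = 0. -/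
open scoped Classical

open ArithmeticFunction ArithmeticFunction.vonMangoldt in
/-- The sum of the reciprocals of the primes in an invertible residue class diverges. -/
theorem not_summable_one_div_primes_residueClass {q : ℕ} [NeZero q] {a : ZMod q}
    (ha : IsUnit a) :
    ¬ Summable fun n : ℕ ↦ if n.Prime ∧ (n : ZMod q) = a then (1 : ℝ) / n else 0 := by
  intro H
  set g : ℕ → ℝ := fun n ↦ if n.Prime ∧ (n : ZMod q) = a then (1 : ℝ) / n else 0 with hg
  have hg₀ (n : ℕ) : 0 ≤ g n := by
    simp only [hg]; positivity
  set h : ℕ → ℝ := fun n ↦ (if n.Prime then 0 else residueClass a n) / n with hh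
  have hsum : Summable h := summable_residueClass_non_primes_div a
  have hh₀ (n : ℕ) : 0 ≤ h n := by
    have := residueClass_nonneg a n
    simp only [hh]; positivity
  obtain ⟨C, hC⟩ := LSeries_residueClass_lower_bound ha
  set c : ℝ := (q.totient : ℝ)⁻¹
  have hc : 0 < c := inv_pos.mpr (mod_cast q.totient.pos_of_neZero)
  obtain ⟨s, hs⟩ : ∃ s : Finset ℕ, ∑' n, g n - c / 2 < ∑ n ∈ s, g n :=
    (H.hasSum.eventually (lt_mem_nhds (sub_lt_self _ (half_pos hc)))).exists
  let u : ℕ → ℝ := fun n ↦ if n ∈ s then g n * Real.log n else 0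
  let v : ℕ → ℝ := fun n ↦ if n ∈ s then g n else 0
  have hu : HasSum u (∑ n ∈ s, g n * Real.log n) := by
    have : HasSum u (∑ n ∈ s, u n) := hasSum_sum_of_ne_finset_zero fun n hn ↦ if_neg hn
    rwa [Finset.sum_congr rfl (fun n hn ↦ if_pos hn)] at this
  have hv : HasSum v (∑ n ∈ s, g n) := by
    have : HasSum v (∑ n ∈ s, v n) := hasSum_sum_of_ne_finset_zero fun n hn ↦ if_neg hn
    rwa [Finset.sum_congr rfl (fun n hn ↦ if_pos hn)] at this
  set D : ℝ := ∑' n, h n + ∑ n ∈ s, g n * Real.log n + C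
  have key {ε : ℝ} (hε : 0 < ε) (hε₁ : ε ≤ 1) : c ≤ 2 * ε * D := by
    have hpt (n : ℕ) :
        residueClass a n / (n : ℝ) ^ (1 + ε) ≤ h n + u n + ε⁻¹ * (g n - v n) := by
      rcases n.eq_zero_or_pos with rfl | hn
      · simp [hh, u, v, hg]
      have hn' : (0 : ℝ) < n := mod_cast hn
      have hn1 : (1 : ℝ) ≤ n := mod_cast hn
      have hpow : (n : ℝ) ≤ (n : ℝ) ^ (1 + ε) := by
        simpa using Real.rpow_le_rpow_of_exponent_le hn1 (by linarith : (1 : ℝ) ≤ 1 + ε)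
      have hle : residueClass a n / (n : ℝ) ^ (1 + ε) ≤ residueClass a n / n :=
        div_le_div_of_nonneg_left (residueClass_nonneg a n) hn' hpow
      have hvg : v n ≤ g n := by
        by_cases hns : n ∈ s <;> simp [v, hns, hg₀]
      have hu₀ : 0 ≤ u n := by
        by_cases hns : n ∈ s
        · simpa [u, hns] using mul_nonneg (hg₀ n) (Real.log_nonneg hn1)
        · simp [u, hns]
      have hgv : 0 ≤ ε⁻¹ * (g n - v n) :=
        mul_nonneg (inv_nonneg.mpr hε.le) (sub_nonneg.mpr hvg)
      by_cases hp : n.Prime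
      · by_cases hna : (n : ZMod q) = a
        · have hr : residueClass a n = Real.log n := by
            simp [residueClass, hna, vonMangoldt_apply_prime hp]
          have hgn : g n = 1 / n := by simp [hg, hp, hna]
          by_cases hns : n ∈ s
          · have : u n = Real.log n / n := by simp [u, hns, hgn]; ring
            rw [hr] at hle ⊢
            linarith [hh₀ n]
          · have hvn : v n = 0 := by simp [v, hns]
            have hlog := Real.log_le_rpow_div hn'.le hε
            have : Real.log n / (n : ℝ) ^ (1 + ε) ≤ ε⁻¹ * (1 / n) := by
              rw [Real.rpow_add hn', Real.rpow_one, div_le_iff₀ (by positivity)]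
              calc Real.log n ≤ (n : ℝ) ^ ε / ε := hlog
                _ = _ := by field_simp
            rw [hr, hvn, hgn, sub_zero]
            linarith [hh₀ n]
        · have hr : residueClass a n = 0 := by simp [residueClass, hna]
          rw [hr, zero_div]
          linarith [hh₀ n]
      · have : h n = residueClass a n / n := by simp [hh, hp]
        linarith
    have hR : Summable fun n ↦ h n + u n + ε⁻¹ * (g n - v n) :=
      (hsum.add hu.summable).add ((H.sub hv.summable).mul_left _)
    have hL : Summable fun n : ℕ ↦ residueClass a n / (n : ℝ) ^ (1 + ε) :=
      hR.of_nonneg_of_le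
        (fun n ↦ div_nonneg (residueClass_nonneg a n) (by positivity)) hpt
    have h₁ := hL.tsum_le_tsum hpt hR
    rw [((hsum.hasSum.add hu).add ((H.hasSum.sub hv).mul_left ε⁻¹)).tsum_eq] at h₁
    have h₂ := hC (x := 1 + ε) ⟨by linarith, by linarith⟩
    rw [add_sub_cancel_left] at h₂
    have h₃ : ε⁻¹ * (∑' n, g n - ∑ n ∈ s, g n) ≤ ε⁻¹ * (c / 2) :=
      mul_le_mul_of_nonneg_left (by linarith) (inv_nonneg.mpr hε.le)
    have h₄ : c / ε ≤ D + ε⁻¹ * (c / 2) := by linarith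
    rw [div_le_iff₀ hε, add_mul, mul_right_comm, inv_mul_cancel₀ hε.ne'] at h₄
    linarith
  have hD : 0 < |D| + 1 := by positivity
  have hε : 0 < min 1 (c / (2 * (|D| + 1))) := lt_min one_pos (by positivity)
  have h₁ := key hε (min_le_left _ _)
  have h₂ : min 1 (c / (2 * (|D| + 1))) * (2 * (|D| + 1)) ≤ c :=
    (le_div_iff₀ (by positivity)).mp (min_le_right _ _)
  nlinarith [le_abs_self D]

/-- Counting residues modulo a product of coprime moduli. -/
theorem card_filter_range_mul_le {A B : ℕ} (hAB : A.Coprime B) (hA : 0 < A) (hB : 0 < B)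
    (P Q R : ℕ → Prop) [DecidablePred P] [DecidablePred Q] [DecidablePred R]
    (hP : ∀ n, R n → P (n % A)) (hQ : ∀ n, R n → Q (n % B)) :
    ((Finset.range (A * B)).filter R).card ≤
      ((Finset.range A).filter P).card * ((Finset.range B).filter Q).card := by
  rw [← Finset.card_product]
  refine Finset.card_le_card_of_injOn (fun n ↦ (n % A, n % B)) (fun n hn ↦ ?_) ?_
  · simp only [Finset.coe_filter, Finset.mem_range, Set.mem_ofPred_eq] at hn
    simp [Nat.mod_lt _ hA, Nat.mod_lt _ hB, hP n hn.2, hQ n hn.2]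
  · intro m hm n hn hmn
    simp only [Finset.coe_filter, Finset.mem_range, Set.mem_ofPred_eq] at hm hn
    simp only [Prod.mk.injEq] at hmn
    exact ((Nat.modEq_and_modEq_iff_modEq_mul hAB).mp hmn).eq_of_lt_of_lt hm.1 hn.1

/-- An upper bound for the number of elements below `X` satisfying a property that depends only
on the residue modulo `M`. -/
theorem card_filter_range_le_of_mod {M : ℕ} (hM : 0 < M) (X : ℕ) (R Q : ℕ → Prop)
    [DecidablePred R] [DecidablePred Q]
    (hR : ∀ n < X, R n → Q (n % M)) :
    ((Finset.range X).filter R).card ≤ ((Finset.range M).filter Q).card * (X / M + 1) := by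
  rw [← Finset.card_range (X / M + 1), ← Finset.card_product]
  refine Finset.card_le_card_of_injOn (fun n ↦ (n % M, n / M)) (fun n hn ↦ ?_) ?_
  · simp only [Finset.coe_filter, Finset.mem_range, Set.mem_ofPred_eq] at hn
    simp [Nat.mod_lt _ hM, hR n hn.1 hn.2, Nat.div_le_div_right hn.1.le]
  · intro m _ n _ hmn
    simp only [Prod.mk.injEq] at hmn
    rw [← Nat.mod_add_div m M, ← Nat.mod_add_div n M, hmn.1, hmn.2]

/-- Residues modulo `p ^ 2` that are not exactly divisible by `p`. -/
theorem card_filter_dvd_imp_sq_dvd_le {p : ℕ} (hp : p.Prime) :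
    (((Finset.range (p ^ 2)).filter (fun n ↦ p ∣ n → p ^ 2 ∣ n)).card : ℝ) ≤
      (p : ℝ) ^ 2 * Real.exp (-(1 / (2 * p))) := by
  have hp0 : (0 : ℝ) < p := mod_cast hp.pos
  have hp2 : (2 : ℝ) ≤ p := mod_cast hp.two_le
  have hsub : (Finset.Ico 1 p).image (p * ·) ⊆ Finset.range (p ^ 2) := by
    intro n hn
    simp only [Finset.mem_image, Finset.mem_Ico, Finset.mem_range] at hn ⊢
    obtain ⟨k, ⟨_, hk⟩, rfl⟩ := hn
    rw [sq]
    exact Nat.mul_lt_mul_of_pos_left hk hp.pos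
  have hle : ((Finset.range (p ^ 2)).filter (fun n ↦ p ∣ n → p ^ 2 ∣ n)).card ≤
      (Finset.range (p ^ 2) \ (Finset.Ico 1 p).image (p * ·)).card := by
    refine Finset.card_le_card fun n hn ↦ ?_
    simp only [Finset.mem_filter, Finset.mem_sdiff, Finset.mem_image, Finset.mem_Ico] at hn ⊢
    refine ⟨hn.1, ?_⟩
    rintro ⟨k, ⟨hk1, hk⟩, rfl⟩
    have := hn.2 (dvd_mul_right p k)
    rw [sq] at this
    exact absurd (Nat.le_of_dvd hk1 (Nat.dvd_of_mul_dvd_mul_left hp.pos this)) (by lia)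
  have hcard : (Finset.range (p ^ 2) \ (Finset.Ico 1 p).image (p * ·)).card + (p - 1) =
      p ^ 2 := by
    have := Finset.card_sdiff_add_card_eq_card hsub
    rwa [Finset.card_image_of_injective _ (mul_right_injective₀ hp.ne_zero),
      Nat.card_Ico, Finset.card_range] at this
  have hreal : (((Finset.range (p ^ 2)).filter (fun n ↦ p ∣ n → p ^ 2 ∣ n)).card : ℝ) + (p - 1) ≤
      (p : ℝ) ^ 2 := by
    rw [← Nat.cast_one, ← Nat.cast_sub hp.one_le]
    exact_mod_cast (by lia)
  have hexp := Real.one_sub_le_exp_neg (1 / (2 * (p : ℝ)))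
  have hmul := mul_le_mul_of_nonneg_left hexp (sq_nonneg (p : ℝ))
  have : (p : ℝ) ^ 2 * (1 - 1 / (2 * p)) = (p : ℝ) ^ 2 - p / 2 := by field_simp
  linarith

theorem dvd_imp_sq_dvd_mod {p M n : ℕ} (hM : p ^ 2 ∣ M) (h : p ∣ n → p ^ 2 ∣ n) :
    p ∣ n % M → p ^ 2 ∣ n % M := by
  rw [Nat.dvd_mod_iff hM, Nat.dvd_mod_iff ((dvd_pow_self p two_ne_zero).trans hM)]
  exact h

/-- Residues modulo `∏ p ^ 2` that are not exactly divisible by any of the primes `p`. -/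
theorem card_filter_forall_dvd_imp_sq_dvd_le (P : Finset ℕ) (hP : ∀ p ∈ P, p.Prime) :
    (((Finset.range (∏ p ∈ P, p ^ 2)).filter
        (fun n ↦ ∀ p ∈ P, p ∣ n → p ^ 2 ∣ n)).card : ℝ) ≤
      (∏ p ∈ P, p ^ 2 : ℕ) * Real.exp (-∑ p ∈ P, 1 / (2 * (p : ℝ))) := by
  induction P using Finset.induction_on with
  | empty => simp
  | insert p P hp ih =>
    have hpp := hP p (Finset.mem_insert_self p P)
    have hP' : ∀ l ∈ P, l.Prime := fun l hl ↦ hP l (Finset.mem_insert_of_mem hl)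
    rw [Finset.prod_insert hp, Finset.sum_insert hp, neg_add, Real.exp_add]
    have hco : (p ^ 2).Coprime (∏ l ∈ P, l ^ 2) :=
      Nat.Coprime.prod_right fun l hl ↦ Nat.Coprime.pow _ _ <|
        (Nat.coprime_primes hpp (hP' l hl)).mpr fun h ↦ hp (h ▸ hl)
    have hle := card_filter_range_mul_le hco (pow_pos hpp.pos 2)
      (Finset.prod_pos fun l hl ↦ pow_pos (hP' l hl).pos 2)
      (fun n ↦ p ∣ n → p ^ 2 ∣ n) (fun n ↦ ∀ l ∈ P, l ∣ n → l ^ 2 ∣ n)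
      (fun n ↦ ∀ l ∈ insert p P, l ∣ n → l ^ 2 ∣ n)
      (fun n hn ↦ dvd_imp_sq_dvd_mod dvd_rfl (hn p (Finset.mem_insert_self p P)))
      (fun n hn l hl ↦ dvd_imp_sq_dvd_mod (Finset.dvd_prod_of_mem (· ^ 2) hl)
        (hn l (Finset.mem_insert_of_mem hl)))
    refine (Nat.cast_le (α := ℝ).mpr hle).trans ?_
    rw [Nat.cast_mul]
    refine (mul_le_mul (card_filter_dvd_imp_sq_dvd_le hpp) (ih hP') (by positivity)
      (by positivity)).trans_eq ?_
    rw [Nat.cast_mul, Nat.cast_pow]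
    ring

/-- A prime congruent to `3` modulo `4` never divides a sum of two squares exactly once. -/
theorem sq_dvd_of_dvd_sq_add_sq {p n : ℕ} (hp : p.Prime) (hp4 : p % 4 = 3) {a b : ℤ}
    (hn : (n : ℤ) = a ^ 2 + b ^ 2) (h : p ∣ n) : p ^ 2 ∣ n := by
  have : Fact p.Prime := ⟨hp⟩
  rcases eq_or_ne n 0 with rfl | hn₀
  · exact dvd_zero _
  have hnat : n = a.natAbs ^ 2 + b.natAbs ^ 2 := by
    zify
    simpa using hn
  have heven := Nat.eq_sq_add_sq_iff.mp ⟨_, _, hnat⟩ p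
    (Nat.mem_primeFactors.mpr ⟨hp, h, hn₀⟩) hp4
  have h1 : 1 ≤ padicValNat p n := one_le_padicValNat_of_dvd hn₀ h
  rw [padicValNat_dvd_iff_le hn₀]
  obtain ⟨k, hk⟩ := heven
  lia

/-- There are finite sets of primes congruent to `3` modulo `4` whose reciprocals have
arbitrarily large sum. -/
theorem exists_finset_primes_three_mod_four_le_sum (B : ℝ) :
    ∃ P : Finset ℕ, (∀ p ∈ P, p.Prime ∧ p % 4 = 3) ∧ B ≤ ∑ p ∈ P, 1 / (p : ℝ) := by
  have hunit : IsUnit (3 : ZMod 4) := by decide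
  have hdiv := (not_summable_iff_tendsto_nat_atTop_of_nonneg
    (fun n ↦ by positivity)).mp (not_summable_one_div_primes_residueClass hunit)
  obtain ⟨N, hN⟩ := (hdiv.eventually_ge_atTop B).exists
  refine ⟨(Finset.range N).filter fun n ↦ n.Prime ∧ (n : ZMod 4) = 3, fun p hp ↦ ?_, ?_⟩
  · obtain ⟨_, hp, hp3⟩ := Finset.mem_filter.mp hp
    refine ⟨hp, ?_⟩
    exact (ZMod.natCast_eq_natCast_iff' p 3 4).mp (by exact_mod_cast hp3)
  · rwa [Finset.sum_filter]

/-- The positive integers that are sums of two integer squares have natural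
density zero. -/
theorem stmt17 :
    Filter.Tendsto
      (fun X : ℕ =>
        (((Finset.range X).filter
            (fun n => 0 < n ∧ ∃ a b : ℤ, (n : ℤ) = a ^ 2 + b ^ 2)).card : ℝ) / X)
      Filter.atTop (nhds 0) := by
  rw [Metric.tendsto_atTop]
  intro ε hε
  obtain ⟨P, hP, hsum⟩ := exists_finset_primes_three_mod_four_le_sum (2 * -Real.log (ε / 2))
  have hexp : Real.exp (-∑ p ∈ P, 1 / (2 * (p : ℝ))) ≤ ε / 2 := by
    rw [← Real.le_log_iff_exp_le (half_pos hε)]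
    have : ∑ p ∈ P, 1 / (2 * (p : ℝ)) = (∑ p ∈ P, 1 / (p : ℝ)) / 2 := by
      rw [Finset.sum_div]
      exact Finset.sum_congr rfl fun p _ ↦ by rw [div_div, mul_comm]
    linarith
  set M : ℕ := ∏ p ∈ P, p ^ 2
  have hM : 0 < M := Finset.prod_pos fun p hp ↦ pow_pos (hP p hp).1.pos 2
  have hM' : (0 : ℝ) < M := mod_cast hM
  refine ⟨M + 1, fun X hX ↦ ?_⟩
  have hX' : (M : ℝ) < X := mod_cast hX
  have hcount := card_filter_range_le_of_mod hM X
    (fun n ↦ 0 < n ∧ ∃ a b : ℤ, (n : ℤ) = a ^ 2 + b ^ 2)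
    (fun n ↦ ∀ p ∈ P, p ∣ n → p ^ 2 ∣ n)
    (fun n _ ⟨_, a, b, hab⟩ p hp ↦ dvd_imp_sq_dvd_mod (Finset.dvd_prod_of_mem (· ^ 2) hp)
      (sq_dvd_of_dvd_sq_add_sq (hP p hp).1 (hP p hp).2 hab))
  have hres := (card_filter_forall_dvd_imp_sq_dvd_le P fun p hp ↦ (hP p hp).1).trans
    (mul_le_mul_of_nonneg_left hexp (Nat.cast_nonneg _))
  have hdiv : ((X / M : ℕ) : ℝ) ≤ X / M := Nat.cast_div_le
  rw [Real.dist_eq, sub_zero, abs_of_nonneg (by positivity), div_lt_iff₀ (hM'.trans hX')]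
  have hcast : ((Finset.range X : Finset ℤ).filter
      (fun n ↦ 0 < n ∧ ∃ a b : ℤ, (n : ℤ) = a ^ 2 + b ^ 2)).card ≤
      ((Finset.range X).filter
        (fun n : ℕ ↦ 0 < n ∧ ∃ a b : ℤ, (n : ℤ) = a ^ 2 + b ^ 2)).card := by
    refine (Finset.card_le_card fun z hz ↦ ?_).trans (Finset.card_image_le (f := ((↑) : ℕ → ℤ)))
    simp only [Finset.bind_def, Finset.pure_def, Finset.mem_filter, Finset.mem_sup,
      Finset.mem_singleton, Finset.mem_image] at hz ⊢
    obtain ⟨⟨k, hk, rfl⟩, hpos, hab⟩ := hz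
    exact ⟨k, ⟨hk, by exact_mod_cast hpos, hab⟩, rfl⟩
  calc _ ≤ _ := Nat.cast_le.mpr (hcast.trans hcount)
    _ ≤ (M * (ε / 2)) * ((X : ℝ) / M + 1) := by
      push_cast
      gcongr
    _ = ε / 2 * (X + M) := by field_simp
    _ < ε * X := by nlinarith
end

section
/- Let D be a nonsquare positive integer with D ≡ 0 or 1 (mod 4), and let Q₀ be the principal form of discriminant D. Then there exist integers x, y with Q₀(x, y) ≡ −1 (mod D) if and only if 16 does not divide D and no prime factor of D is congruent to 3 mod 4. (This is the statement that the class [−1] lies in the subgroup H_D ⊂ (ℤ/Dℤ)^× of residues represented by the principal form if and only if 16 ∤ D and D has no prime factor ≡ 3 mod 4.) -/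
/-- The principal form of discriminant `D`. -/
def Qprin (D x y : ℤ) : ℤ :=
  if D % 4 = 0 then x ^ 2 - (D / 4) * y ^ 2 else x ^ 2 + x * y + ((1 - D) / 4) * y ^ 2

/-- A square root of `-1` modulo `m` lifts modulo `p * m` for a prime `p ∣ m`, `p ≠ 2`. -/
lemma exists_dvd_sq_add_one_of_prime_dvd {p m : ℕ} (hp : p.Prime) (hp2 : p ≠ 2) (hpm : p ∣ m)
    {z : ℤ} (hz : (m : ℤ) ∣ z ^ 2 + 1) : ∃ w : ℤ, ((p * m : ℕ) : ℤ) ∣ w ^ 2 + 1 := by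
  have hp' : Prime (p : ℤ) := Nat.prime_iff_prime_int.mp hp
  have hndvd : ¬ (p : ℤ) ∣ 2 * z := by
    intro h
    rcases hp'.dvd_or_dvd h with h2 | h2
    · exact hp2 ((Nat.prime_dvd_prime_iff_eq hp Nat.prime_two).mp (by exact_mod_cast h2))
    · have h1 : (p : ℤ) ∣ z ^ 2 + 1 := (Int.natCast_dvd_natCast.mpr hpm).trans hz
      exact hp'.not_dvd_one ((dvd_add_right (dvd_pow h2 two_ne_zero)).mp h1)
  obtain ⟨a, b, hab⟩ := (Prime.coprime_iff_not_dvd hp').mpr hndvd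
  obtain ⟨k, hk⟩ := hz
  obtain ⟨l, rfl⟩ := hpm
  refine ⟨z - (p * l : ℕ) * (b * k), k * a + l * (b * k) ^ 2, ?_⟩
  push_cast at hk ⊢
  linear_combination hk - (p * l * k : ℤ) * hab

lemma exists_dvd_sq_add_one_of_primes_mod_four (m : ℕ)
    (hm : ∀ p : ℕ, p.Prime → p ∣ m → p % 4 = 1) :
    m % 4 = 1 ∧ ∃ z : ℤ, (m : ℤ) ∣ z ^ 2 + 1 := by
  induction m using induction_on_primes with
  | zero => exact absurd (hm 2 Nat.prime_two (dvd_zero _)) (by norm_num)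
  | one => exact ⟨rfl, 0, by simp⟩
  | prime_mul p m hp ih =>
    obtain ⟨hm4, z, hz⟩ := ih fun q hq h => hm q hq (h.mul_left p)
    have hp4 := hm p hp (dvd_mul_right p m)
    refine ⟨by rw [Nat.mul_mod, hp4, hm4], ?_⟩
    by_cases hpm : p ∣ m
    · exact exists_dvd_sq_add_one_of_prime_dvd hp (by rintro rfl; omega) hpm hz
    have hroot (n : ℕ) : IsSquare (-1 : ZMod n) ↔ ∃ z : ℤ, (n : ℤ) ∣ z ^ 2 + 1 := by
      rw [IsSquare, (ZMod.intCast_surjective (n := n)).exists]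
      refine exists_congr fun z => ?_
      rw [← ZMod.intCast_zmod_eq_zero_iff_dvd]
      push_cast
      rw [sq, eq_comm, ← sub_eq_zero, sub_neg_eq_add]
    have := Fact.mk hp
    exact (hroot _).mp (ZMod.isSquare_neg_one_mul ((Nat.Prime.coprime_iff_not_dvd hp).mpr hpm)
      (ZMod.exists_sq_eq_neg_one_iff.mpr (by omega)) ((hroot m).mpr ⟨z, hz⟩))

/-- No prime congruent to `3` mod `4` divides a sum `a ^ 2 + b ^ 2` unless it divides `b`. -/
lemma mod_four_ne_three_of_dvd_sq_add_sq {p : ℕ} (hp : p.Prime) {a b : ℤ}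
    (hb : ¬ (p : ℤ) ∣ b) (h : (p : ℤ) ∣ a ^ 2 + b ^ 2) : p % 4 ≠ 3 := by
  have := Fact.mk hp
  have hb' : (b : ZMod p) ≠ 0 := by rwa [Ne, ZMod.intCast_zmod_eq_zero_iff_dvd]
  rw [← ZMod.intCast_zmod_eq_zero_iff_dvd] at h
  push_cast at h
  refine ZMod.mod_four_ne_three_of_sq_eq_neg_sq' (x := (a : ZMod p)) (y := b) hb' ?_
  linear_combination h

/-- Four times the principal form is `u ^ 2 - D * v ^ 2`. -/
lemma four_mul_Qprin {D : ℤ} (hmod : D % 4 = 0 ∨ D % 4 = 1) (x y : ℤ) :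
    ∃ u : ℤ, 4 * Qprin D x y = u ^ 2 - D * y ^ 2 := by
  unfold Qprin
  split_ifs with h
  · have hD : 4 * (D / 4) = D := by omega
    exact ⟨2 * x, by linear_combination (-y ^ 2) * hD⟩
  · have hD : 4 * ((1 - D) / 4) = 1 - D := by omega
    exact ⟨2 * x + y, by linear_combination y ^ 2 * hD⟩

/-- `[−1]` is represented mod `D` by the principal form iff `16 ∤ D` and `D` has
no prime factor `≡ 3 mod 4`. -/
theorem stmt18 (D : ℤ) (hpos : 0 < D) (hns : ¬ IsSquare D)
    (hmod : D % 4 = 0 ∨ D % 4 = 1) :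
    (∃ x y : ℤ, Qprin D x y ≡ -1 [ZMOD D]) ↔
      (¬ (16 ∣ D) ∧ ∀ p : ℕ, p.Prime → (p : ℤ) ∣ D → p % 4 ≠ 3) := by
  constructor
  · rintro ⟨x, y, hxy⟩
    obtain ⟨k, hk⟩ := hxy.symm.dvd
    refine ⟨?_, fun p hp hpD hp3 => ?_⟩
    · rintro ⟨n, rfl⟩
      have h4 : 16 * n / 4 = 4 * n := by omega
      rw [Qprin, if_pos (by omega), h4] at hk
      have hx : x ^ 2 = 4 * (n * y ^ 2 + 4 * n * k) - 1 := by linear_combination hk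
      rcases Int.even_or_odd' x with ⟨c, rfl | rfl⟩ <;> ring_nf at hx <;> omega
    · obtain ⟨u, hu⟩ := four_mul_Qprin hmod x y
      refine mod_four_ne_three_of_dvd_sq_add_sq hp (a := u) (b := 2) ?_ ?_ hp3
      · intro h2
        have := (Nat.prime_dvd_prime_iff_eq hp Nat.prime_two).mp (by exact_mod_cast h2)
        omega
      · exact hpD.trans ⟨4 * k + y ^ 2, by linear_combination 4 * hk - hu⟩
  · rintro ⟨h16, hprime⟩
    have hroot (m : ℤ) (hm0 : 0 < m) (hmD : m ∣ D) (hodd : m % 2 = 1) :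
        m % 4 = 1 ∧ ∃ z : ℤ, m ∣ z ^ 2 + 1 := by
      lift m to ℕ using hm0.le
      obtain ⟨h1, h2⟩ := exists_dvd_sq_add_one_of_primes_mod_four m fun p hp hpm => by
        have h3 := hprime p hp ((Int.natCast_dvd_natCast.mpr hpm).trans hmD)
        have hp2 : ¬ 2 ∣ p := fun h => by have := h.trans hpm; omega
        omega
      exact ⟨by omega, h2⟩
    /- The root may be shifted by `m` to have either parity. -/
    have hparity (m : ℤ) (hm0 : 0 < m) (hmD : m ∣ D) (hodd : m % 2 = 1) (r : ℤ) :
        ∃ c : ℤ, m ∣ (2 * c + r) ^ 2 + 1 := by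
      obtain ⟨-, z, k, hk⟩ := hroot m hm0 hmD hodd
      rcases Int.emod_two_eq_zero_or_one (z - r) with h | h
      · refine ⟨(z - r) / 2, k, ?_⟩
        rw [show 2 * ((z - r) / 2) + r = z by omega, hk]
      · refine ⟨(z + m - r) / 2, k + 2 * z + m, ?_⟩
        rw [show 2 * ((z + m - r) / 2) + r = z + m by omega]
        linear_combination hk
    by_cases h0 : D % 4 = 0
    · obtain ⟨n, rfl⟩ : (4 : ℤ) ∣ D := Int.dvd_of_emod_eq_zero h0
      have hn : 4 * n / 4 = n := by omega
      simp only [Qprin, if_pos h0, hn]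
      rcases Int.emod_two_eq_zero_or_one n with h2 | h2
      · obtain ⟨m, rfl⟩ : (2 : ℤ) ∣ n := Int.dvd_of_emod_eq_zero h2
        have hdvd : m ∣ 4 * (2 * m) := ⟨8, by ring⟩
        have hodd : m % 2 = 1 := by omega
        obtain ⟨hm4, -⟩ := hroot m (by omega) hdvd hodd
        obtain ⟨c, hc⟩ := hparity m (by omega) hdvd hodd 1
        refine ⟨2 * c + 1, 1, Int.ModEq.symm (Int.modEq_iff_dvd.mpr ?_)⟩
        have h8 : (8 : ℤ) ∣ (2 * c + 1) ^ 2 - 2 * m * 1 ^ 2 - -1 := by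
          obtain ⟨t, ht⟩ := (Int.even_mul_succ_self c).two_dvd
          refine ⟨t - m / 4, ?_⟩
          have : m = 4 * (m / 4) + 1 := by omega
          linear_combination 4 * ht - 2 * this
        have hm' : m ∣ (2 * c + 1) ^ 2 - 2 * m * 1 ^ 2 - -1 := by
          obtain ⟨k, hk⟩ := hc
          exact ⟨k - 2, by linear_combination hk⟩
        have hco : IsCoprime (8 : ℤ) m := by
          have : IsCoprime (2 : ℤ) m := ⟨-(m / 2), 1, by omega⟩
          simpa using this.pow_left (m := 3)
        have := hco.mul_dvd h8 hm'
        rwa [show 4 * (2 * m) = 8 * m by ring]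
      · have hdvd : n ∣ 4 * n := dvd_mul_left n 4
        obtain ⟨hn4, -⟩ := hroot n (by omega) hdvd h2
        obtain ⟨c, k, hk⟩ := hparity n (by omega) hdvd h2 0
        refine ⟨2 * c, 1, Int.ModEq.symm (Int.modEq_iff_dvd.mpr ?_)⟩
        have hco : IsCoprime (4 : ℤ) n := ⟨-(n / 4), 1, by omega⟩
        refine hco.mul_dvd ⟨c ^ 2 - n / 4, ?_⟩ ⟨k - 1, by linear_combination hk⟩
        have : n = 4 * (n / 4) + 1 := by omega
        linear_combination -this
    · obtain ⟨-, z, hz⟩ := hroot D hpos dvd_rfl (by omega)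
      refine ⟨z, 0, Int.ModEq.symm (Int.modEq_iff_dvd.mpr ?_)⟩
      simpa [Qprin, h0] using hz
end

section
/- Let φ, ψ ∈ SL₂(ℤ) be Anosov matrices with tr(φ) = tr(ψ) and with Q_φ(x, y) = Q_ψ(x, y) for all integers x, y. Then φ = ψ. (That is, an Anosov matrix in SL₂(ℤ) is uniquely determined by its trace together with its associated quadratic form; explicitly, writing Q_φ = αx² + βxy + γy², t = |tr(φ)| and s = √((t² − 4)/D_φ), one has φ = sgn(tr φ) · !![(t + βs)/2, −γs; αs, (t − βs)/2].) -/
open Matrix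

/-- The integer coefficients of `Q_φ`, which exist since `u(φ)` divides `b`, `c` and `d - a`. -/
theorem exists_matQ_coeffs (φ : Matrix (Fin 2) (Fin 2) ℤ) (hφ : IsAnosov φ) :
    ∃ α β γ : ℤ, φ 1 0 = matU φ * α ∧ φ 1 1 - φ 0 0 = matU φ * β ∧ -φ 0 1 = matU φ * γ ∧
      ∀ x y : ℤ, matQ φ x y = α * x ^ 2 + β * x * y + γ * y ^ 2 := by
  obtain ⟨hdet, htr⟩ := hφ
  rw [det_fin_two] at hdet
  have hne : φ 0 0 + φ 1 1 ≠ 0 := by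
    intro h
    simp [h] at htr
  have hunit : IsUnit (φ 0 0 + φ 1 1).sign := by
    rw [Int.isUnit_iff]
    rcases lt_or_gt_of_ne hne with h | h
    · exact Or.inr (Int.sign_eq_neg_one_of_neg h)
    · exact Or.inl (Int.sign_eq_one_of_pos h)
  have hdvd : ∀ n : ℤ,
      (Int.gcd (φ 0 1) (Int.gcd (φ 1 0) (φ 1 1 - φ 0 0)) : ℤ) ∣ n → matU φ ∣ n :=
    fun n hn => hunit.mul_left_dvd.mpr hn
  have hinner := Int.gcd_dvd_right (φ 0 1) (Int.gcd (φ 1 0) (φ 1 1 - φ 0 0))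
  obtain ⟨γ, hγ⟩ := hdvd _ ((Int.gcd_dvd_left (φ 0 1) _).trans (dvd_neg.mpr dvd_rfl))
  obtain ⟨α, hα⟩ := hdvd _ (hinner.trans (Int.gcd_dvd_left _ _))
  obtain ⟨β, hβ⟩ := hdvd _ (hinner.trans (Int.gcd_dvd_right _ _))
  have hu : matU φ ≠ 0 := by
    intro h
    rw [h, zero_mul] at hα hβ hγ
    have h00 : φ 0 0 = φ 1 1 := by linarith
    have hsq : φ 1 1 * φ 1 1 = 1 := by rw [h00, hα] at hdet; linarith
    rw [h00] at htr
    rcases mul_self_eq_one_iff.mp hsq with h1 | h1 <;> norm_num [h1] at htr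
  refine ⟨α, β, γ, hα, hβ, hγ, fun x y => ?_⟩
  have hfactor : φ 1 0 * x ^ 2 + (φ 1 1 - φ 0 0) * x * y - φ 0 1 * y ^ 2
      = matU φ * (α * x ^ 2 + β * x * y + γ * y ^ 2) := by
    linear_combination x ^ 2 * hα + x * y * hβ + y ^ 2 * hγ
  rw [matQ, hfactor, Int.mul_ediv_cancel_left _ hu]

/-- An Anosov matrix in `SL₂(ℤ)` is determined by its trace and its quadratic
form. -/
theorem stmt19 (φ ψ : Matrix (Fin 2) (Fin 2) ℤ)
    (hφ : IsAnosov φ) (hψ : IsAnosov ψ)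
    (htr : φ 0 0 + φ 1 1 = ψ 0 0 + ψ 1 1)
    (hQ : ∀ x y : ℤ, matQ φ x y = matQ ψ x y) :
    φ = ψ := by
  obtain ⟨α, β, γ, hα, hβ, hγ, hφQ⟩ := exists_matQ_coeffs φ hφ
  obtain ⟨α', β', γ', hα', hβ', hγ', hψQ⟩ := exists_matQ_coeffs ψ hψ
  simp only [hφQ, hψQ] at hQ
  have hαα : α = α' := by simpa using hQ 1 0
  have hγγ : γ = γ' := by simpa using hQ 0 1
  have hββ : β = β' := by simpa [hαα, hγγ] using hQ 1 1
  subst hαα hγγ hββ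
  have hdφ := hφ.1
  have hdψ := hψ.1
  rw [det_fin_two] at hdφ hdψ
  have hDφ : matU φ ^ 2 * (β ^ 2 - 4 * α * γ) = (φ 0 0 + φ 1 1) ^ 2 - 4 := by
    linear_combination -(φ 1 1 - φ 0 0 + matU φ * β) * hβ - 4 * φ 0 1 * hα
      + 4 * matU φ * α * hγ - 4 * hdφ
  have hDψ : matU ψ ^ 2 * (β ^ 2 - 4 * α * γ) = (ψ 0 0 + ψ 1 1) ^ 2 - 4 := by
    linear_combination -(ψ 1 1 - ψ 0 0 + matU ψ * β) * hβ' - 4 * ψ 0 1 * hα'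
      + 4 * matU ψ * α * hγ' - 4 * hdψ
  have hpos : 0 < (φ 0 0 + φ 1 1) ^ 2 - 4 := by
    have h := hφ.2
    rw [← sq_abs]
    nlinarith
  have hD : β ^ 2 - 4 * α * γ ≠ 0 := by
    intro h
    rw [h, mul_zero] at hDφ
    exact hpos.ne hDφ
  have hsq : matU φ ^ 2 = matU ψ ^ 2 :=
    mul_right_cancel₀ hD (by rw [hDφ, hDψ, htr])
  have hs : (φ 0 0 + φ 1 1).sign ^ 2 ≠ 0 := by
    refine pow_ne_zero _ fun h => ?_
    rw [Int.sign_eq_zero_iff_zero.mp h] at hpos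
    norm_num at hpos
  have hu : matU φ = matU ψ := by
    unfold matU at hsq ⊢
    rw [← htr] at hsq ⊢
    rw [mul_pow, mul_pow] at hsq
    congr 1
    exact (sq_eq_sq₀ (Int.natCast_nonneg _) (Int.natCast_nonneg _)).mp
      (mul_left_cancel₀ hs hsq)
  rw [← hu] at hα' hβ' hγ'
  ext i j
  fin_cases i <;> fin_cases j <;> simp <;> linarith
end
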